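/- arXiv:math/9807022 — 5 statements merged into one kernel-verified Lean document; each statement's English description precedes it below -/
import Mathlib

section
/- If G is a chordal graph, then G has a maximum asteroidal set contained in its set S(G) of simplicial vertices; that is, there is an asteroidal set of size a(G) consisting entirely of simplicial vertices. -/
open SimpleGraph

namespace Leafage

variable {V : Type*}

/-- A closed walk has a chord: an edge of the graph joining two vertices of the walk
that is not an edge of the walk. -/
def HasChord (G : SimpleGraph V) {v : V} (c : G.Walk v v) : Prop :=
  ∃ x y, x ∈ c.support ∧ y ∈ c.support ∧ G.Adj x y ∧ s(x, y) ∉ c.edges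

/-- A graph is chordal if every cycle of length exceeding 3 has a chord. -/
def IsChordal (G : SimpleGraph V) : Prop :=
  ∀ (v : V) (c : G.Walk v v), c.IsCycle → 3 < c.length → HasChord G c

/-- A leaf of a tree is a vertex of degree 1. -/
def IsLeaf (T : SimpleGraph V) (v : V) : Prop := (T.neighborSet v).ncard = 1

/-- The number of leaves of a tree. -/
noncomputable def numLeaves (T : SimpleGraph V) : ℕ := {v | IsLeaf T v}.ncard

/-- A subtree of a tree `T`, described by its vertex set: a set of vertices inducing a
(nonempty) connected subgraph. -/
def IsSubtree (T : SimpleGraph V) (S : Set V) : Prop := (T.induce S).Connected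

/-- A subtree representation of `G` in a host tree `T`: each vertex `v` is assigned a
subtree `f v` of `T`, and distinct vertices are adjacent iff their subtrees meet. -/
def IsSubtreeRep {α β : Type*} (G : SimpleGraph α) (T : SimpleGraph β) (f : α → Set β) : Prop :=
  (∀ v, IsSubtree T (f v)) ∧ ∀ u v, u ≠ v → (G.Adj u v ↔ (f u ∩ f v).Nonempty)

/-- A proper subtree representation: no subtree properly contains another. -/
def IsProperSubtreeRep {α β : Type*} (G : SimpleGraph α) (T : SimpleGraph β)
    (f : α → Set β) : Prop :=
  IsSubtreeRep G T f ∧ ∀ u v, u ≠ v → ¬ f u ⊂ f v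

/-- The leafage of a graph: the minimum number of leaves of the host tree over all
subtree representations. -/
noncomputable def leafage {α : Type*} (G : SimpleGraph α) : ℕ :=
  sInf {L | ∃ (m : ℕ) (T : SimpleGraph (Fin m)) (f : α → Set (Fin m)),
    T.IsTree ∧ IsSubtreeRep G T f ∧ numLeaves T = L}

/-- The proper leafage of a graph: the minimum number of leaves of the host tree over all
proper subtree representations. -/
noncomputable def properLeafage {α : Type*} (G : SimpleGraph α) : ℕ :=
  sInf {L | ∃ (m : ℕ) (T : SimpleGraph (Fin m)) (f : α → Set (Fin m)),
    T.IsTree ∧ IsProperSubtreeRep G T f ∧ numLeaves T = L}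

/-- `C` is between `A` and `B` (as subtrees of the tree `T`): `A` and `B` are disjoint and
the unique path of `T` connecting them meets `C` (equivalently, every walk from `A` to `B`
meets `C`). -/
def Between (T : SimpleGraph V) (A B C : Set V) : Prop :=
  Disjoint A B ∧ ∀ u v, u ∈ A → v ∈ B → ∀ p : T.Walk u v, ∃ x ∈ p.support, x ∈ C

/-- An asteroidal collection of subtrees: pairwise disjoint, and none between two others. -/
def AsteroidalCollection {ι : Type*} (T : SimpleGraph V) (Ts : ι → Set V) : Prop :=
  (∀ i j, i ≠ j → Disjoint (Ts i) (Ts j)) ∧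
    ∀ i j k, i ≠ j → j ≠ k → i ≠ k → ¬ Between T (Ts i) (Ts j) (Ts k)

/-- `x, y, z` form an asteroidal triple when each pair is joined by a path avoiding the
closed neighborhood of the third; by symmetry we record the path from `x` to `y`
avoiding `N[z]` and quantify over all orderings in `AsteroidalSet`. -/
def AsteroidalTriple (G : SimpleGraph V) (x y z : V) : Prop :=
  ∃ p : G.Walk x y, ∀ w ∈ p.support, w ≠ z ∧ ¬ G.Adj z w

/-- An asteroidal set: every triple of its vertices is an asteroidal triple. -/
def AsteroidalSet (G : SimpleGraph V) (A : Set V) : Prop :=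
  ∀ x ∈ A, ∀ y ∈ A, ∀ z ∈ A, x ≠ y → y ≠ z → x ≠ z → AsteroidalTriple G x y z

/-- `a(G)`: the maximum size of an asteroidal set in `G`. -/
noncomputable def astNum (G : SimpleGraph V) : ℕ :=
  sSup {n | ∃ A : Set V, AsteroidalSet G A ∧ A.ncard = n}

/-- A simplicial vertex: its neighborhood induces a clique. -/
def IsSimplicial (G : SimpleGraph V) (v : V) : Prop := G.IsClique (G.neighborSet v)

/-- The derived graph `G'`: the induced subgraph on the non-simplicial vertices. -/
def derivedGraph (G : SimpleGraph V) : SimpleGraph {v | ¬ IsSimplicial G v} :=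
  G.induce {v | ¬ IsSimplicial G v}

/-- A cutset: a set of vertices whose deletion leaves a disconnected subgraph. -/
def IsCutset {β : Type*} (H : SimpleGraph β) (S : Set β) : Prop :=
  (Sᶜ : Set β).Nonempty ∧ ¬ (H.induce Sᶜ).Preconnected

/-- A cut-vertex: some two other vertices are connected in `H` but not in `H - v`. -/
def IsCutVertex {β : Type*} (H : SimpleGraph β) (v : β) : Prop :=
  ∃ x y : ({v}ᶜ : Set β), H.Reachable ↑x ↑y ∧ ¬ (H.induce ({v}ᶜ : Set β)).Reachable x y

/-- A `k`-tree: there is a construction ordering of the vertices in which the first `k`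
vertices form a `k`-clique and each later vertex's neighborhood among earlier vertices is
a `k`-clique. -/
def IsKTree (k : ℕ) (G : SimpleGraph V) : Prop :=
  ∃ (n : ℕ) (e : Fin n ≃ V), k ≤ n ∧
    (∀ i j : Fin n, (i : ℕ) < k → (j : ℕ) < k → i ≠ j → G.Adj (e i) (e j)) ∧
    ∀ i : Fin n, k ≤ (i : ℕ) →
      G.IsClique {v | G.Adj (e i) v ∧ ∃ j, j < i ∧ e j = v} ∧
      {v | G.Adj (e i) v ∧ ∃ j, j < i ∧ e j = v}.ncard = k

/-- The collection of modified simplicial neighborhoods `N(v) - S(G)` for `v` simplicial;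
the poset `P(G)` is this collection ordered by inclusion. -/
def modNbhds (G : SimpleGraph V) : Set (Set V) :=
  {R | ∃ v, IsSimplicial G v ∧ R = G.neighborSet v \ {w | IsSimplicial G w}}

/-- The width of a family of sets under inclusion: the maximum size of an antichain. -/
noncomputable def familyWidth {β : Type*} (F : Set (Set β)) : ℕ :=
  sSup {n | ∃ A, A ⊆ F ∧ (∀ x ∈ A, ∀ y ∈ A, x ≠ y → ¬ x ⊆ y) ∧ A.ncard = n}

/-- The restricted simplicial neighborhood poset `P'(G)`: the modified simplicial
neighborhoods that do not contain a cutset of the derived graph `G'`. -/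
def restrictedModNbhds (G : SimpleGraph V) : Set (Set V) :=
  {R ∈ modNbhds G | ¬ ∃ C, C ⊆ R ∧ IsCutset (derivedGraph G) (Subtype.val ⁻¹' C)}

/-- The closed neighborhood `N[a]`. -/
def closedNbhd (G : SimpleGraph V) (a : V) : Set V := insert a (G.neighborSet a)

/-- Two vertices are equivalent if they have the same closed neighborhood. -/
def EquivVerts (G : SimpleGraph V) (u v : V) : Prop := closedNbhd G u = closedNbhd G v

/-- A graph is reduced if no two distinct vertices are equivalent. -/
def IsReduced (G : SimpleGraph V) : Prop := ∀ u v, EquivVerts G u v → u = v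

/-- The boundary `∂H` of a component `H` of `G - N[a]`: the vertices of `N[a]` having a
neighbor in `H`. -/
def compBoundary (G : SimpleGraph V) (a : V)
    (C : (G.induce (closedNbhd G a)ᶜ).ConnectedComponent) : Set V :=
  {x | x ∈ closedNbhd G a ∧ ∃ h : ((closedNbhd G a)ᶜ : Set V),
    (G.induce (closedNbhd G a)ᶜ).connectedComponentMk h = C ∧ G.Adj x ↑h}

/-- A modified extreme point (MEP): a simplicial vertex `a` such that all components of
`G - N[a]` have the same boundary. -/
def IsMEP (G : SimpleGraph V) (a : V) : Prop :=
  IsSimplicial G a ∧ ∀ C₁ C₂ : (G.induce (closedNbhd G a)ᶜ).ConnectedComponent,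
    compBoundary G a C₁ = compBoundary G a C₂

/-- An extreme point (EP): a simplicial vertex `a` such that every pair of distinct
vertices of `N(a)` not equivalent to `a` have a common neighbor outside `N[a]`. -/
def IsEP (G : SimpleGraph V) (a : V) : Prop :=
  IsSimplicial G a ∧ ∀ x ∈ G.neighborSet a, ∀ y ∈ G.neighborSet a, x ≠ y →
    ¬ EquivVerts G x a → ¬ EquivVerts G y a →
      ∃ z, z ∉ closedNbhd G a ∧ G.Adj x z ∧ G.Adj y z

/-- A block of `G`, as a vertex set: a maximal set inducing a connected subgraph
with no cut-vertex. -/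
def IsBlock (G : SimpleGraph V) (B : Set V) : Prop :=
  (G.induce B).Connected ∧ (∀ v : B, ¬ IsCutVertex (G.induce B) v) ∧
    ∀ B', B ⊆ B' → (G.induce B').Connected →
      (∀ v : B', ¬ IsCutVertex (G.induce B') v) → B' = B

/-- A block graph: every block is a clique. -/
def IsBlockGraph (G : SimpleGraph V) : Prop := ∀ B, IsBlock G B → G.IsClique B

/-- A leaf block: a block containing exactly one cut-vertex of `G`. -/
def IsLeafBlock (G : SimpleGraph V) (B : Set V) : Prop :=
  IsBlock G B ∧ {v | v ∈ B ∧ IsCutVertex G v}.ncard = 1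

/-- Claw-free: no induced subgraph isomorphic to `K_{1,3}`. -/
def ClawFree (G : SimpleGraph V) : Prop :=
  ¬ ∃ a b c d : V, b ≠ c ∧ b ≠ d ∧ c ≠ d ∧ G.Adj a b ∧ G.Adj a c ∧ G.Adj a d ∧
    ¬ G.Adj b c ∧ ¬ G.Adj b d ∧ ¬ G.Adj c d

/-- The set of the first `i+1` vertices in the ordering `e`. -/
def prefixSet {n : ℕ} (e : Fin n ≃ V) (i : Fin n) : Set V := {v | ∃ j, j ≤ i ∧ e j = v}

/-- A perfect elimination ordering, read in reverse (build order) as `e 0, e 1, …`: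
the neighborhood of each vertex among earlier vertices is a clique. -/
def IsPEO (G : SimpleGraph V) {n : ℕ} (e : Fin n ≃ V) : Prop :=
  ∀ i : Fin n, G.IsClique {v | G.Adj (e i) v ∧ ∃ j, j < i ∧ e j = v}

/-- `Q` is a maximal clique within the vertex set `W`. -/
def MaxCliqueIn (G : SimpleGraph V) (W Q : Set V) : Prop :=
  Q ⊆ W ∧ G.IsClique Q ∧ ∀ Q', Q' ⊆ W → G.IsClique Q' → Q ⊆ Q' → Q' = Q

/-- The creation time of a maximal clique `C` of `G` with respect to the build order `e`:
the first step at which the part of `C` built so far is a maximal clique of the graph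
built so far. -/
noncomputable def creationTime (G : SimpleGraph V) {n : ℕ} (e : Fin n ≃ V)
    (C : Set V) : ℕ :=
  sInf {t | ∃ i : Fin n, (i : ℕ) = t ∧ MaxCliqueIn G (prefixSet e i) (C ∩ prefixSet e i)}

/-- `Q` is the creation ordering of the maximal cliques of `G` with respect to the perfect
elimination ordering `e`: an enumeration of all maximal cliques of `G` listed in order of
creation. -/
def IsCreationOrdering (G : SimpleGraph V) {n : ℕ} (e : Fin n ≃ V) {m : ℕ}
    (Q : Fin m → Set V) : Prop :=
  Function.Injective Q ∧ (∀ i, MaxCliqueIn G Set.univ (Q i)) ∧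
    (∀ C, MaxCliqueIn G Set.univ C → ∃ i, Q i = C) ∧
    StrictMono fun i => creationTime G e (Q i)

/-- The width of the subposet of a poset on the set `S`: the maximum size of an
antichain contained in `S`. -/
noncomputable def widthIn {P : Type*} [PartialOrder P] (S : Set P) : ℕ :=
  sSup {n | ∃ A : Set P, A ⊆ S ∧ IsAntichain (· ≤ ·) A ∧ A.ncard = n}

end Leafage

namespace Leafage

variable {V : Type*}

/-- `u` and `v` are joined by a walk of `G` staying inside the set `X`. -/
def ReachableIn (G : SimpleGraph V) (X : Set V) (u v : V) : Prop :=
  ∃ p : G.Walk u v, ∀ w ∈ p.support, w ∈ X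

/-- The vertices outside the closed neighborhood of `a`. -/
def farFrom (G : SimpleGraph V) (a : V) : Set V := {w | w ≠ a ∧ ¬ G.Adj a w}

section ReachableIn

variable {G : SimpleGraph V} {X Y : Set V} {u v w : V}

lemma ReachableIn.refl (hu : u ∈ X) : ReachableIn G X u u :=
  ⟨Walk.nil, by simpa using hu⟩

lemma ReachableIn.symm (h : ReachableIn G X u v) : ReachableIn G X v u := by
  obtain ⟨p, hp⟩ := h
  exact ⟨p.reverse, by simpa using hp⟩

lemma ReachableIn.trans (h : ReachableIn G X u v) (h' : ReachableIn G X v w) :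
    ReachableIn G X u w := by
  obtain ⟨p, hp⟩ := h
  obtain ⟨q, hq⟩ := h'
  refine ⟨p.append q, fun x hx => ?_⟩
  rcases Walk.mem_support_append_iff p q |>.1 hx with hx | hx
  exacts [hp x hx, hq x hx]

lemma ReachableIn.mono (hXY : X ⊆ Y) (h : ReachableIn G X u v) : ReachableIn G Y u v := by
  obtain ⟨p, hp⟩ := h
  exact ⟨p, fun x hx => hXY (hp x hx)⟩

lemma ReachableIn.left_mem (h : ReachableIn G X u v) : u ∈ X := by
  obtain ⟨p, hp⟩ := h
  exact hp u p.start_mem_support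

lemma ReachableIn.right_mem (h : ReachableIn G X u v) : v ∈ X := h.symm.left_mem

lemma ReachableIn.of_adj (h : G.Adj u v) (hu : u ∈ X) (hv : v ∈ X) : ReachableIn G X u v :=
  ⟨h.toWalk, by simp [hu, hv]⟩

/-- A walk inside `X` stays within the component of `X` containing its start. -/
lemma ReachableIn.in_component (h : ReachableIn G X u v) :
    ReachableIn G {w | ReachableIn G X u w} u v := by
  classical
  obtain ⟨p, hp⟩ := h
  refine ⟨p, fun w hw => ⟨p.takeUntil w hw, fun x hx => hp x ?_⟩⟩
  exact p.support_takeUntil_subset_support hw hx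

end ReachableIn

/-- A shortest walk among those inside a given set is a path without shortcuts. -/
lemma ReachableIn.exists_induced_path {G : SimpleGraph V} {X : Set V} {u v : V}
    (h : ReachableIn G X u v) :
    ∃ p : G.Walk u v, p.IsPath ∧ (∀ w ∈ p.support, w ∈ X) ∧
      ∀ x ∈ p.support, ∀ y ∈ p.support, G.Adj x y → s(x, y) ∈ p.edges := by
  classical
  let P : ℕ → Prop := fun n => ∃ p : G.Walk u v, (∀ w ∈ p.support, w ∈ X) ∧ p.length = n
  have hP : ∃ n, P n := by
    obtain ⟨p, hp⟩ := h
    exact ⟨_, p, hp, rfl⟩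
  obtain ⟨q, hqX, hqlen⟩ := Nat.find_spec hP
  have hmin : ∀ r : G.Walk u v, (∀ w ∈ r.support, w ∈ X) → Nat.find hP ≤ r.length :=
    fun r hr => Nat.find_min' hP ⟨r, hr, rfl⟩
  have hpX : ∀ w ∈ q.bypass.support, w ∈ X :=
    fun w hw => hqX w (q.support_bypass_subset_support hw)
  have hplen : q.bypass.length ≤ Nat.find hP := hqlen ▸ q.length_bypass_le_length
  have hpath := q.bypass_isPath
  generalize q.bypass = p at hpX hplen hpath
  refine ⟨p, hpath, hpX, ?_⟩
  have key : ∀ i j, i < j → j ≤ p.length → G.Adj (p.getVert i) (p.getVert j) →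
      s(p.getVert i, p.getVert j) ∈ p.edges := by
    intro i j hij hj hadj
    have hle := hmin ((p.take i).append (Walk.cons hadj (p.drop j))) (by
      intro w hw
      simp only [Walk.mem_support_append_iff, Walk.support_cons, List.mem_cons] at hw
      rcases hw with hw | rfl | hw
      · exact hpX w ((p.isSubwalk_take i).support_subset hw)
      · exact hpX _ (p.getVert_mem_support i)
      · exact hpX w ((p.isSubwalk_drop j).support_subset hw))
    simp only [Walk.length_append, Walk.length_cons, Walk.take_length, Walk.drop_length] at hle
    obtain rfl : j = i + 1 := by omega
    exact (Walk.mk_mem_edges_iff_exists p).2 ⟨i, by omega, rfl⟩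
  intro x hx y hy hadj
  obtain ⟨i, rfl, hi⟩ := Walk.mem_support_iff_exists_getVert.1 hx
  obtain ⟨j, rfl, hj⟩ := Walk.mem_support_iff_exists_getVert.1 hy
  rcases lt_trichotomy i j with hij | rfl | hij
  · exact key i j hij hj hadj
  · exact (G.loopless.irrefl _ hadj).elim
  · rw [Sym2.eq_swap]
    exact key j i hij hi hadj.symm

/-- In a chordal graph, two neighbors of `a` joined by a walk whose interior avoids `N[a]`
are adjacent. -/
lemma IsChordal.adj_of_reachableIn {G : SimpleGraph V} (hG : IsChordal G) {a u v : V}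
    (hau : G.Adj a u) (hav : G.Adj a v) (huv : u ≠ v)
    (h : ReachableIn G ({u, v} ∪ farFrom G a) u v) : G.Adj u v := by
  by_contra hnadj
  obtain ⟨p, hpath, hpX, hind⟩ := h.exists_induced_path
  have ha : a ∉ p.support := by
    intro ha
    rcases hpX a ha with (h | h) | h
    · exact hau.ne h
    · exact hav.ne h
    · exact h.1 rfl
  have hlen : 2 ≤ p.length := by
    by_contra! hlt
    interval_cases hp : p.length
    · exact huv (Walk.eq_of_length_eq_zero hp)
    · exact hnadj (Walk.adj_of_length_eq_one hp)
  let c : G.Walk a a := Walk.cons hau (p.concat hav.symm)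
  have hedges : ∀ e, e ∈ c.edges ↔ e = s(a, u) ∨ e ∈ p.edges ∨ e = s(v, a) := by
    simp [c, Walk.edges_concat]
  have hc : c.IsCycle := by
    refine (Walk.cons_isCycle_iff _ _).2 ⟨hpath.concat ha hav.symm, ?_⟩
    simp only [Walk.edges_concat, List.concat_eq_append, List.mem_append, List.mem_singleton,
      not_or]
    refine ⟨fun h => ha (p.fst_mem_support_of_mem_edges h), fun h => ?_⟩
    rcases Sym2.eq_iff.1 h with ⟨h, -⟩ | ⟨-, h⟩
    · exact hav.ne h
    · exact huv h
  have hclen : 3 < c.length := by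
    simp only [c, Walk.length_cons, Walk.length_concat]
    omega
  have hsupp : ∀ x ∈ c.support, x = a ∨ x ∈ p.support := by
    intro x hx
    simp only [c, Walk.support_cons, Walk.support_concat,
      List.mem_cons, List.mem_append, List.not_mem_nil, or_false] at hx
    tauto
  have hapex : ∀ y ∈ p.support, G.Adj a y → s(a, y) ∈ c.edges := by
    intro y hy hadj
    rw [hedges]
    rcases hpX y hy with (h | h) | h
    · exact .inl (by rw [h])
    · exact .inr (.inr (by rw [Set.mem_singleton_iff.1 h, Sym2.eq_swap]))
    · exact (h.2 hadj).elim
  obtain ⟨x, y, hx, hy, hadj, hxy⟩ := hG a c hc hclen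
  rcases hsupp x hx with rfl | hxp <;> rcases hsupp y hy with rfl | hyp
  · exact G.loopless.irrefl _ hadj
  · exact hxy (hapex y hyp hadj)
  · exact hxy (Sym2.eq_swap ▸ hapex x hxp hadj.symm)
  · exact hxy ((hedges _).2 (.inr (.inl (hind x hxp y hyp hadj))))

/-- The vertices of `U` outside `H` with a neighbor in `H`. -/
def boundaryIn (G : SimpleGraph V) (U H : Set V) : Set V :=
  {v | v ∈ U ∧ v ∉ H ∧ ∃ h ∈ H, G.Adj h v}

/-- The component of `b` in the subgraph induced by `U - N[a]`. -/
def farComponent (G : SimpleGraph V) (U : Set V) (a b : V) : Set V :=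
  {h | ReachableIn G (U ∩ farFrom G a) b h}

lemma farComponent_subset {G : SimpleGraph V} {U : Set V} {a b : V} :
    farComponent G U a b ⊆ U ∩ farFrom G a :=
  fun _ hh => ReachableIn.right_mem hh

lemma adj_of_mem_boundaryIn_farComponent {G : SimpleGraph V} {U : Set V} {a b v : V}
    (hv : v ∈ boundaryIn G U (farComponent G U a b)) : G.Adj a v := by
  obtain ⟨hvU, hvH, h, hh, hadj⟩ := hv
  have hf := (farComponent_subset hh).2
  by_contra hav
  refine hvH (ReachableIn.trans hh (.of_adj hadj (farComponent_subset hh) ⟨hvU, ?_, hav⟩))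
  rintro rfl
  exact hf.2 hadj.symm

/-- In a chordal graph, the boundary of a component of `U - N[a]` is a clique. -/
lemma IsChordal.isClique_boundaryIn_farComponent {G : SimpleGraph V} (hG : IsChordal G)
    (U : Set V) (a b : V) : G.IsClique (boundaryIn G U (farComponent G U a b)) := by
  intro u hu v hv huv
  refine hG.adj_of_reachableIn (adj_of_mem_boundaryIn_farComponent hu)
    (adj_of_mem_boundaryIn_farComponent hv) huv ?_
  obtain ⟨-, -, h, hh, hhu⟩ := hu
  obtain ⟨-, -, k, hk, hkv⟩ := hv
  have hhk : ReachableIn G ({u, v} ∪ farFrom G a) h k :=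
    ((ReachableIn.symm hh).trans hk).mono fun x hx => .inr hx.2
  exact (ReachableIn.of_adj hhu.symm (by simp) hhk.left_mem).trans
    (hhk.trans (.of_adj hkv hhk.right_mem (by simp)))

/-- A form of Dirac's theorem: in a chordal graph, every induced subgraph `U` has a simplicial
vertex outside any given clique that is not all of `U`. -/
lemma IsChordal.exists_simplicial_in [Finite V] {G : SimpleGraph V} (hG : IsChordal G) :
    ∀ U K : Set V, G.IsClique K → (U \ K).Nonempty →
      ∃ s ∈ U \ K, G.IsClique (G.neighborSet s ∩ U) := by
  intro U
  induction hn : U.ncard using Nat.strong_induction_on generalizing U with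
  | _ n ih =>
  intro K hK hne
  by_cases hU : G.IsClique U
  · obtain ⟨s, hs⟩ := hne
    exact ⟨s, hs, hU.subset Set.inter_subset_right⟩
  obtain ⟨a, haU, b, hbU, hab, hnadj⟩ : ∃ a ∈ U, ∃ b ∈ U, a ≠ b ∧ ¬ G.Adj a b := by
    simpa [IsClique, Set.Pairwise] using hU
  have hS := hG.isClique_boundaryIn_farComponent U a b
  have hSa : ∀ v ∈ boundaryIn G U (farComponent G U a b), G.Adj a v :=
    fun v hv => adj_of_mem_boundaryIn_farComponent hv
  have hHU := farComponent_subset (G := G) (U := U) (a := a) (b := b)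
  have hbH : b ∈ farComponent G U a b := ReachableIn.refl ⟨hbU, hab.symm, hnadj⟩
  have hSdef : boundaryIn G U (farComponent G U a b) =
    {v | v ∈ U ∧ v ∉ farComponent G U a b ∧ ∃ h ∈ farComponent G U a b, G.Adj h v} := rfl
  generalize farComponent G U a b = H at *
  generalize boundaryIn G U H = S at *
  have haH : a ∉ H := fun h => (hHU h).2.1 rfl
  have haS : a ∉ S := fun h => G.loopless.irrefl _ (hSa a h)
  have hSmem : ∀ v, v ∈ S ↔ v ∈ U ∧ v ∉ H ∧ ∃ h ∈ H, G.Adj h v := fun v => by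
    rw [hSdef]; rfl
  have hsub₁ : H ∪ S ⊂ U := by
    refine (Set.ssubset_iff_of_subset ?_).2 ⟨a, haU, by simp [haH, haS]⟩
    exact Set.union_subset (fun x hx => (hHU hx).1) fun x hx => ((hSmem x).1 hx).1
  have hsub₂ : U \ H ⊂ U :=
    (Set.ssubset_iff_of_subset Set.sdiff_subset).2 ⟨b, hbU, by simp [hbH]⟩
  obtain ⟨s, hs, hsc⟩ := ih _ (hn ▸ Set.ncard_lt_ncard hsub₁ U.toFinite) (H ∪ S) rfl S hS
    ⟨b, .inl hbH, fun h => ((hSmem b).1 h).2.1 hbH⟩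
  obtain ⟨t, ht, htc⟩ := ih _ (hn ▸ Set.ncard_lt_ncard hsub₂ U.toFinite) (U \ H) rfl S hS
    ⟨a, ⟨haU, haH⟩, haS⟩
  have hsH : s ∈ H := hs.1.resolve_right hs.2
  have hst : ¬ G.Adj s t := fun h => ht.2 ((hSmem t).2 ⟨ht.1.1, ht.1.2, s, hsH, h⟩)
  have hst' : s ≠ t := fun h => ht.1.2 (h ▸ hsH)
  by_cases hsK : s ∈ K
  · refine ⟨t, ⟨ht.1.1, fun htK => hst (hK hsK htK hst')⟩, htc.subset ?_⟩
    exact fun x hx => ⟨hx.1, hx.2, fun hxH =>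
      ht.2 ((hSmem t).2 ⟨ht.1.1, ht.1.2, x, hxH, G.adj_symm hx.1⟩)⟩
  · refine ⟨s, ⟨(hHU hsH).1, hsK⟩, hsc.subset ?_⟩
    refine fun x hx => ⟨hx.1, ?_⟩
    by_cases hxH : x ∈ H
    · exact .inl hxH
    · exact .inr ((hSmem x).2 ⟨hx.2, hxH, s, hsH, hx.1⟩)

/-- In a chordal graph, any clique that is not the whole vertex set misses a simplicial vertex. -/
lemma IsChordal.exists_isSimplicial_notMem [Finite V] {G : SimpleGraph V} (hG : IsChordal G)
    {K : Set V} (hK : G.IsClique K) {v : V} (hv : v ∉ K) : ∃ s, s ∉ K ∧ IsSimplicial G s := by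
  obtain ⟨s, hs, hsc⟩ := hG.exists_simplicial_in Set.univ K hK ⟨v, trivial, hv⟩
  exact ⟨s, hs.2, by simpa [IsSimplicial] using hsc⟩

/-- For a component `H` of `G - N[a]` in a chordal graph, some simplicial vertex is joined to `a`
by a walk avoiding `N[z]` for all `z ∈ H`. -/
lemma IsChordal.exists_isSimplicial_separated [Finite V] {G : SimpleGraph V} (hG : IsChordal G)
    (a b : V) :
    ∃ s, IsSimplicial G s ∧ ∀ z ∈ farComponent G Set.univ a b,
      ReachableIn G (farFrom G z) a s := by
  have hS := hG.isClique_boundaryIn_farComponent Set.univ a b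
  have haS : a ∉ boundaryIn G Set.univ (farComponent G Set.univ a b) :=
    fun h => G.loopless.irrefl _ (adj_of_mem_boundaryIn_farComponent h)
  have haH : a ∉ farComponent G Set.univ a b := fun h => (farComponent_subset h).2.1 rfl
  generalize farComponent G Set.univ a b = H at *
  set S := boundaryIn G Set.univ H
  have hmemS : ∀ {h v}, h ∈ H → G.Adj h v → v ∉ H → v ∈ S :=
    fun hh hadj hv => ⟨trivial, hv, _, hh, hadj⟩
  let C : Set V := {c | ReachableIn G (H ∪ S)ᶜ a c}
  have haC : a ∈ C := ReachableIn.refl (by simp [haH, haS])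
  obtain ⟨s, hs, hsc⟩ := hG.exists_simplicial_in (C ∪ S) S hS ⟨a, .inl haC, haS⟩
  have hsC : ReachableIn G (H ∪ S)ᶜ a s := hs.1.resolve_right hs.2
  have hsX := hsC.right_mem
  refine ⟨s, hsc.subset ?_, fun z hz => hsC.mono fun w hw => ?_⟩
  · refine fun x hx => ⟨hx, ?_⟩
    by_cases hxS : x ∈ S
    · exact .inr hxS
    have hxH : x ∉ H := fun hxH => hs.2 (hmemS hxH (G.adj_symm hx) fun h => hsX (.inl h))
    exact .inl (hsC.trans (.of_adj hx hsX (by simp [hxH, hxS])))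
  · refine ⟨?_, fun hadj => hw (.inr (hmemS hz hadj fun h => hw (.inl h)))⟩
    rintro rfl
    exact hw (.inl hz)

lemma asteroidalSet_iff {G : SimpleGraph V} {A : Set V} :
    AsteroidalSet G A ↔ ∀ x ∈ A, ∀ y ∈ A, ∀ z ∈ A, x ≠ y → y ≠ z → x ≠ z →
      ReachableIn G (farFrom G z) x y := Iff.rfl

lemma asteroidalSet_of_ncard_le_two [Finite V] (G : SimpleGraph V) {A : Set V}
    (hA : A.ncard ≤ 2) : AsteroidalSet G A := by
  intro x hx y hy z hz hxy hyz hxz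
  have : 2 < A.ncard := (Set.two_lt_ncard_iff A.toFinite).2 ⟨x, y, z, hx, hy, hz, hxy, hxz, hyz⟩
  omega

/-- A non-simplicial vertex of an asteroidal set of size at least three in a chordal graph can be
exchanged for a simplicial one. -/
lemma IsChordal.exists_exchange [Finite V] {G : SimpleGraph V} (hG : IsChordal G) {A : Set V}
    (hA : AsteroidalSet G A) (hcard : 2 < A.ncard) {a : V} (ha : a ∈ A) :
    ∃ s, IsSimplicial G s ∧ s ∉ A \ {a} ∧ AsteroidalSet G (insert s (A \ {a})) := by
  rw [asteroidalSet_iff] at hA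
  have hcard' : 1 < (A \ {a}).ncard := by
    have := Set.ncard_sdiff_singleton_add_one ha A.toFinite
    omega
  obtain ⟨b, c, ⟨hb, hba⟩, ⟨hc, hca⟩, hbc⟩ := (Set.one_lt_ncard_iff (Set.toFinite _)).1 hcard'
  rw [Set.mem_singleton_iff] at hba hca
  have hH : ∀ x ∈ A \ {a}, x ∈ farComponent G Set.univ a b := by
    rintro x ⟨hx, hxa⟩
    rw [Set.mem_singleton_iff] at hxa
    rw [farComponent, Set.univ_inter]
    by_cases hbx : b = x
    · subst hbx
      exact ReachableIn.refl (hA b hb c hc a ha hbc hca hba).left_mem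
    · exact hA b hb x hx a ha hbx hxa hba
  obtain ⟨s, hs, hsH⟩ := hG.exists_isSimplicial_separated a b
  have hsA : s ∉ A \ {a} := fun h => (hsH s (hH s h)).right_mem.1 rfl
  have hstart : ∀ y ∈ A \ {a}, ∀ z ∈ A \ {a}, y ≠ z → ReachableIn G (farFrom G z) s y :=
    fun y hy z hz hyz => (hsH z (hH z hz)).symm.trans
      (hA a ha y hy.1 z hz.1 (Ne.symm hy.2) hyz (Ne.symm hz.2))
  have hfar : farComponent G Set.univ a b ⊆ farFrom G s := fun z hz =>
    ⟨fun h => (hsH z hz).right_mem.1 h.symm, fun h => (hsH z hz).right_mem.2 h.symm⟩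
  refine ⟨s, hs, hsA, asteroidalSet_iff.2 ?_⟩
  rintro x (rfl | hx) y (rfl | hy) z (rfl | hz) hxy hyz hxz
  any_goals contradiction
  · exact hstart y hy z hz hyz
  · exact (hstart x hx z hz hxz).symm
  · have hcomp : ∀ w ∈ A \ {a}, ReachableIn G (farComponent G Set.univ a b) b w :=
      fun w hw => ReachableIn.in_component (hH w hw)
    exact ((hcomp x hx).symm.trans (hcomp y hy)).mono hfar
  · exact hA x hx.1 y hy.1 z hz.1 hxy hyz hxz

/-- In a chordal graph, every asteroidal set has the same size as some asteroidal set of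
simplicial vertices. -/
lemma IsChordal.exists_asteroidalSet_isSimplicial [Finite V] {G : SimpleGraph V}
    (hG : IsChordal G) {A : Set V} (hA : AsteroidalSet G A) :
    ∃ B : Set V, AsteroidalSet G B ∧ (∀ v ∈ B, IsSimplicial G v) ∧ B.ncard = A.ncard := by
  rcases le_or_gt A.ncard 2 with hle | hlt
  · suffices h : ∃ B : Set V, (∀ v ∈ B, IsSimplicial G v) ∧ B.ncard = A.ncard by
      obtain ⟨B, hB, hBA⟩ := h
      exact ⟨B, asteroidalSet_of_ncard_le_two G (hBA ▸ hle), hB, hBA⟩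
    rcases A.eq_empty_or_nonempty with rfl | ⟨v, hv⟩
    · exact ⟨∅, by simp⟩
    obtain ⟨s, -, hs⟩ := hG.exists_isSimplicial_notMem (K := ∅) (by simp) (Set.notMem_empty v)
    have hpos := (Set.ncard_pos A.toFinite).2 ⟨v, hv⟩
    by_cases h1 : A.ncard = 1
    · exact ⟨{s}, by simpa using hs, by simp [h1]⟩
    · obtain ⟨w, -, hw⟩ := Set.exists_ne_of_one_lt_ncard (s := A) (by omega) s
      obtain ⟨t, hts, ht⟩ := hG.exists_isSimplicial_notMem (K := {s}) (by simp) hw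
      rw [Set.mem_singleton_iff] at hts
      refine ⟨{s, t}, by simp [hs, ht], ?_⟩
      rw [Set.ncard_pair (Ne.symm hts)]
      omega
  · induction hn : {v ∈ A | ¬ IsSimplicial G v}.ncard using Nat.strong_induction_on
      generalizing A with
    | _ n ih =>
    by_cases hall : ∀ v ∈ A, IsSimplicial G v
    · exact ⟨A, hA, hall, rfl⟩
    push Not at hall
    obtain ⟨a, ha, has⟩ := hall
    obtain ⟨s, hs, hsA, hast⟩ := hG.exists_exchange hA hlt ha
    have hsub : {v ∈ insert s (A \ {a}) | ¬ IsSimplicial G v} ⊂ {v ∈ A | ¬ IsSimplicial G v} := by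
      refine (Set.ssubset_iff_of_subset ?_).2 ⟨a, ⟨ha, has⟩, ?_⟩
      · rintro v ⟨rfl | hv, hvs⟩
        · exact (hvs hs).elim
        · exact ⟨hv.1, hvs⟩
      · rintro ⟨rfl | h, -⟩
        · exact has hs
        · exact h.2 rfl
    have hcard : (insert s (A \ {a})).ncard = A.ncard := by
      rw [Set.ncard_insert_of_notMem hsA, Set.ncard_sdiff_singleton_add_one ha]
    obtain ⟨B, hB⟩ := ih _ (hn ▸ Set.ncard_lt_ncard hsub (Set.toFinite _)) hast
      (hcard ▸ hlt) rfl
    exact ⟨B, hcard ▸ hB⟩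

end Leafage

open SimpleGraph Leafage

theorem stmt13 {V : Type*} [Fintype V] (G : SimpleGraph V) (hG : IsChordal G) :
    ∃ A : Set V, AsteroidalSet G A ∧ (∀ v ∈ A, IsSimplicial G v) ∧
      A.ncard = astNum G := by
  obtain ⟨A, hA, hcard⟩ : astNum G ∈ {n | ∃ A : Set V, AsteroidalSet G A ∧ A.ncard = n} := by
    refine Nat.sSup_mem ⟨0, ∅, by simp [AsteroidalSet], by simp⟩ ⟨Nat.card V, ?_⟩
    rintro n ⟨A, -, rfl⟩
    exact Set.ncard_le_card A
  rw [← hcard]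
  exact hG.exists_asteroidalSet_isSimplicial hA
end

section
/- Let P be a finite poset, let A_P be its unique minimal maximum antichain, and let C be the chain containing an element x ∈ A_P in some Dilworth decomposition of P. If C' is the chain consisting of x together with all elements above x in C, then w(P − C') = w(P) − 1; equivalently, P has a Dilworth decomposition using C' as one of its chains. -/
open SimpleGraph

open SimpleGraph Leafage

/-- A coloring whose color classes are chains is injective on every antichain. -/
theorem IsAntichain.injOn_of_isChain_fiber {P ι : Type*} [PartialOrder P] {c : P → ι}
    (hc : ∀ i, IsChain (· ≤ ·) {y | c y = i}) {A : Set P} (hA : IsAntichain (· ≤ ·) A) :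
    Set.InjOn c A := by
  intro a ha b hb hab
  rcases (hc (c b)).total (show a ∈ {y | c y = c b} from hab)
    (show b ∈ {y | c y = c b} from rfl) with h | h
  · exact hA.eq ha hb h
  · exact (hA.eq hb ha h).symm

theorem stmt14 {P : Type*} [Fintype P] [PartialOrder P]
    (w : ℕ) (hw : w = widthIn (Set.univ : Set P))
    (AP : Set P) (hAPanti : IsAntichain (· ≤ ·) AP) (hAPcard : AP.ncard = w)
    (hAPmin : ∀ B : Set P, IsAntichain (· ≤ ·) B → B.ncard = w →
      ∀ x ∈ AP, ∃ y ∈ B, x ≤ y)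
    (c : P → Fin w) (hc : ∀ i, IsChain (· ≤ ·) {y | c y = i})
    (x : P) (hx : x ∈ AP) :
    widthIn ({y | c y = c x ∧ x ≤ y}ᶜ : Set P) = w - 1 := by
  refine IsGreatest.csSup_eq ⟨⟨AP \ {x}, ?_, hAPanti.subset Set.sdiff_subset, ?_⟩, ?_⟩
  · rintro y ⟨hy, hyx⟩ ⟨hcy, -⟩
    exact hyx (hAPanti.injOn_of_isChain_fiber hc hy hx hcy)
  · rw [Set.ncard_sdiff_singleton_of_mem hx, hAPcard]
  · rintro n ⟨B, hBS, hB, rfl⟩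
    have hcard : (c '' B).ncard = B.ncard := (hB.injOn_of_isChain_fiber hc).ncard_image
    by_contra! hlt
    have hle : (c '' B).ncard ≤ w := by simpa using Set.ncard_le_card (c '' B)
    have hBw : B.ncard = w := by omega
    have hsurj : c '' B = Set.univ :=
      Set.eq_of_subset_of_ncard_le (Set.subset_univ _) (by simp [hcard, hBw])
    obtain ⟨b, hb, hbx⟩ : c x ∈ c '' B := hsurj ▸ Set.mem_univ _
    have hnot : ¬ x ≤ b := fun h => hBS hb ⟨hbx, h⟩
    have hle' : b ≤ x := ((hc (c x)).total (show b ∈ {y | c y = c x} from hbx)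
      (show x ∈ {y | c y = c x} from rfl)).resolve_right hnot
    obtain ⟨y, hy, hxy⟩ := hAPmin B hB hBw x hx
    exact hnot (hB.eq hb hy (hle'.trans hxy) ▸ hxy)
end

section
/- If G is a connected chordal graph and S is a minimal cutset of G, then every component of G − S contains a vertex adjacent to every vertex of S. -/
open SimpleGraph

open SimpleGraph Leafage

namespace SimpleGraph

variable {V : Type*} {G : SimpleGraph V}

theorem Walk.isChordless_of_length_eq_dist {u v : V} (p : G.Walk u v)
    (hp : p.length = G.dist u v) : p.IsChordless := by
  classical
  rw [Walk.isChordless_iff_forall_mem_edges]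
  induction p with
  | nil =>
    intro x y hx hy h
    simp only [Walk.support_nil, List.mem_singleton] at hx hy
    exact absurd (hx.trans hy.symm) h.ne
  | @cons u w v h q ih =>
    have hq : q.length = G.dist w v := length_eq_dist_of_subwalk hp (q.isSubwalk_cons h)
    have key : ∀ y ∈ q.support, G.Adj u y → y = w := by
      intro y hy huy
      have h1 := dist_le (Walk.cons huy (q.dropUntil y hy))
      have h2 := congrArg Walk.length (q.take_spec hy)
      rw [Walk.length_append] at h2
      rw [Walk.length_cons] at h1 hp
      exact (Walk.eq_of_length_eq_zero (p := q.takeUntil y hy) (by lia)).symm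
    intro x y hx hy hxy
    rw [Walk.support_cons, List.mem_cons] at hx hy
    rw [Walk.edges_cons, List.mem_cons]
    rcases hx with rfl | hx <;> rcases hy with rfl | hy
    · exact absurd rfl hxy.ne
    · exact Or.inl (by rw [key y hy hxy])
    · exact Or.inl (by rw [key x hx hxy.symm, Sym2.eq_swap])
    · exact Or.inr (ih hq hx hy hxy)

/-- A walk ending at a vertex satisfying `P` can be cut short and stopped at the first
vertex satisfying `P`. -/
theorem Walk.exists_walk_to_first {u v : V} (p : G.Walk u v) {P : V → Prop} (hv : P v) :
    ∃ (w : V) (q : G.Walk u w), P w ∧ q.support ⊆ p.support ∧ ∀ z ∈ q.support, P z → z = w := by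
  induction p with
  | nil => exact ⟨_, .nil, hv, by simp, by simp⟩
  | @cons u w v h p ih =>
    by_cases hu : P u
    · exact ⟨u, .nil, hu, by simp, by simp⟩
    · obtain ⟨w', q, hw', hqp, hq⟩ := ih hv
      refine ⟨w', .cons h q, hw', ?_, ?_⟩
      · rw [Walk.support_cons, Walk.support_cons]
        exact List.cons_subset_cons _ hqp
      · intro z hz hPz
        rw [Walk.support_cons, List.mem_cons] at hz
        rcases hz with rfl | hz
        · exact absurd hPz hu
        · exact hq z hz hPz

/-- Two vertices having neighbors on a walk through `A` are joined by a path through `A` whose only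
possible chord is the edge between its endpoints. -/
theorem exists_isPath_chord_eq {A : Set V} {s t x y : V} (hst : s ≠ t) (q : G.Walk x y)
    (hqA : ∀ z ∈ q.support, z ∈ A) (hs : s ∉ A) (ht : t ∉ A) (hsx : G.Adj s x)
    (hyt : G.Adj y t) :
    ∃ p : G.Walk s t, p.IsPath ∧ (∀ z ∈ p.support, z = s ∨ z = t ∨ z ∈ A) ∧
      (∀ a ∈ p.support, ∀ b ∈ p.support, G.Adj a b → s(a, b) ∈ p.edges ∨ s(a, b) = s(s, t)) ∧
      1 < p.length := by
  classical
  let B : Set V := {z | z = s ∨ z = t ∨ z ∈ A}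
  let H : SimpleGraph V :=
    { Adj := fun a b => G.Adj a b ∧ a ∈ B ∧ b ∈ B ∧ s(a, b) ≠ s(s, t)
      symm := ⟨fun a b h => ⟨h.1.symm, h.2.2.1, h.2.1, by rw [Sym2.eq_swap]; exact h.2.2.2⟩⟩
      loopless := ⟨fun a h => h.1.ne rfl⟩ }
  have hle : H ≤ G := fun a b h => h.1
  have hr : ∀ {a b : V} (w : G.Walk a b), (∀ z ∈ w.support, z ∈ A) → H.Reachable a b := by
    intro a b w
    induction w with
    | nil => exact fun _ => .rfl
    | @cons a c b h w ih =>
      intro hA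
      have ha : a ∈ A := hA a (by simp)
      have hc : c ∈ A := hA c (by simp)
      refine .trans (Adj.reachable (G := H) ⟨h, .inr (.inr ha), .inr (.inr hc), ?_⟩)
        (ih fun z hz => hA z (by simp [hz]))
      rw [Ne, Sym2.eq_iff]
      rintro (⟨rfl, -⟩ | ⟨rfl, -⟩)
      · exact hs ha
      · exact ht ha
  have hx : x ∈ A := hqA x q.start_mem_support
  have hy : y ∈ A := hqA y q.end_mem_support
  have h1 : H.Adj s x := by
    refine ⟨hsx, .inl rfl, .inr (.inr hx), ?_⟩
    rw [Ne, Sym2.eq_iff]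
    rintro (⟨-, rfl⟩ | ⟨-, rfl⟩)
    · exact ht hx
    · exact hs hx
  have h2 : H.Adj y t := by
    refine ⟨hyt, .inr (.inr hy), .inr (.inl rfl), ?_⟩
    rw [Ne, Sym2.eq_iff]
    rintro (⟨rfl, -⟩ | ⟨rfl, -⟩)
    · exact hs hy
    · exact ht hy
  have hR : H.Reachable s t := h1.reachable.trans ((hr q hqA).trans h2.reachable)
  obtain ⟨p, hp, hpd⟩ := hR.exists_path_of_dist
  have hpB : ∀ {a b : V} (w : H.Walk a b), b ∈ B → ∀ z ∈ w.support, z ∈ B := by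
    intro a b w hb
    induction w with
    | nil => simpa using hb
    | @cons a c b h w ih =>
      intro z hz
      rw [Walk.support_cons, List.mem_cons] at hz
      rcases hz with rfl | hz
      · exact h.2.1
      · exact ih hb z hz
  have hpB := hpB p (.inr (.inl rfl))
  refine ⟨p.mapLe hle, (Walk.isPath_mapLe hle).2 hp, ?_, ?_, ?_⟩
  · intro z hz
    rw [Walk.support_mapLe_eq_support] at hz
    exact hpB z hz
  · intro a ha b hb hab
    simp only [Walk.support_mapLe_eq_support, Walk.edges_mapLe_eq_edges] at ha hb ⊢
    by_contra! hcon
    exact hcon.1 ((p.isChordless_of_length_eq_dist hpd).mem_edges ha hb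
      ⟨hab, hpB a ha, hpB b hb, hcon.2⟩)
  · rw [Walk.length_mapLe, hpd]
    exact hR.one_lt_dist_of_ne_of_not_adj hst fun h => h.2.2.2 rfl

/-- A component of `G - S` with no neighbor in `S \ T` is closed under walks in `G - T`. -/
theorem ConnectedComponent.mem_of_induce_walk {S T : Set V} (C : (G.induce Sᶜ).ConnectedComponent)
    (hC : ∀ s ∈ S, s ∉ T → ∀ x : (Sᶜ : Set V), (G.induce Sᶜ).connectedComponentMk x = C →
      ¬ G.Adj x s) {a b : (Tᶜ : Set V)} (p : (G.induce Tᶜ).Walk a b)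
    (ha : ∃ h : (a : V) ∈ Sᶜ, (G.induce Sᶜ).connectedComponentMk ⟨a, h⟩ = C) :
    ∃ h : (b : V) ∈ Sᶜ, (G.induce Sᶜ).connectedComponentMk ⟨b, h⟩ = C := by
  induction p with
  | nil => exact ha
  | @cons a c b h p ih =>
    obtain ⟨haS, haC⟩ := ha
    have hac : G.Adj a c := h
    have hcS : (c : V) ∈ Sᶜ := fun hcS => hC c hcS c.2 ⟨a, haS⟩ haC hac
    refine ih ⟨hcS, ?_⟩
    rw [← haC, ConnectedComponent.eq]
    exact Adj.reachable (G := G.induce Sᶜ) hac.symm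

theorem ConnectedComponent.exists_walk_support {S : Set V} {C : (G.induce Sᶜ).ConnectedComponent}
    {x y : (Sᶜ : Set V)} (hx : (G.induce Sᶜ).connectedComponentMk x = C)
    (hy : (G.induce Sᶜ).connectedComponentMk y = C) :
    ∃ p : G.Walk (x : V) y, ∀ z ∈ p.support, z ∈ Subtype.val '' C.supp := by
  obtain ⟨p⟩ := ConnectedComponent.exact (hx.trans hy.symm)
  refine ⟨p.map (Embedding.induce Sᶜ).toHom, fun z hz => ?_⟩
  obtain ⟨w, hw, rfl⟩ :=
    List.mem_map.1 ((congrArg (z ∈ ·) (Walk.support_map (Embedding.induce Sᶜ).toHom p)).mp hz)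
  classical
  exact ⟨w, (ConnectedComponent.sound (p.takeUntil w hw).reachable).symm.trans hx, rfl⟩

end SimpleGraph

namespace Leafage

variable {V : Type*} {G : SimpleGraph V}

theorem IsChordal.exists_chord_of_paths (hG : IsChordal G) {s t : V} (p : G.Walk s t)
    (q : G.Walk t s) (hp : p.IsPath) (hq : q.IsPath)
    (hpq : ∀ z ∈ p.support, z ∈ q.support → z = s ∨ z = t)
    (hlp : 1 < p.length) (hl : 3 < p.length + q.length) :
    ∃ x y, (x ∈ p.support ∨ x ∈ q.support) ∧ (y ∈ p.support ∨ y ∈ q.support) ∧ G.Adj x y ∧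
      s(x, y) ∉ p.edges ∧ s(x, y) ∉ q.edges := by
  have hd : p.support.tail.Disjoint q.support.tail := by
    intro z hzp hzq
    have hs : s ∉ p.support.tail := by
      have := hp.support_nodup
      rw [← p.cons_tail_support] at this
      exact (List.nodup_cons.1 this).1
    have ht : t ∉ q.support.tail := by
      have := hq.support_nodup
      rw [← q.cons_tail_support] at this
      exact (List.nodup_cons.1 this).1
    rcases hpq z (List.mem_of_mem_tail hzp) (List.mem_of_mem_tail hzq) with rfl | rfl
    · exact hs hzp
    · exact ht hzq
  obtain ⟨x, y, hx, hy, hxy, he⟩ := hG s (p.append q) (hp.isCycle_append hq hd (.inl hlp))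
    (by rwa [Walk.length_append])
  rw [Walk.mem_support_append_iff] at hx hy
  rw [Walk.edges_append, List.mem_append, not_or] at he
  exact ⟨x, y, hx, hy, hxy, he.1, he.2⟩

theorem IsChordal.adj_of_walk_of_unique (hG : IsChordal G) {s t x y : V} (hst : G.Adj s t)
    (q : G.Walk x y) (hs : s ∉ q.support) (ht : t ∉ q.support) (hsy : G.Adj s y)
    (htx : G.Adj t x) (huniq : ∀ z ∈ q.support, G.Adj s z → z = y) : G.Adj t y := by
  obtain ⟨p, hp, hpA, hchord, hl⟩ := exists_isPath_chord_eq (A := {z | z ∈ q.support}) hst.ne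
    q.reverse (by simp) hs ht hsy htx.symm
  by_contra hty
  have hl' : 2 < p.length := by
    by_contra! hlen
    have h2 : p.length = 2 := by lia
    have h01 := p.adj_getVert_succ (i := 0) (by lia)
    have h12 := p.adj_getVert_succ (i := 1) (by lia)
    rw [Walk.getVert_zero] at h01
    rw [show 1 + 1 = p.length from h2.symm, Walk.getVert_length] at h12
    rcases hpA _ (p.getVert_mem_support 1) with h | h | h
    · exact h01.ne h.symm
    · exact h12.ne h
    · rw [huniq _ h h01] at h12
      exact hty h12.symm
  obtain ⟨a, b, ha, hb, hab, hep, heq⟩ := hG.exists_chord_of_paths p hst.symm.toWalk hp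
    (by simpa using hst.ne.symm) (by simp; tauto) hl (by simp; lia)
  have hsub : ∀ z, z ∈ p.support ∨ z ∈ hst.symm.toWalk.support → z ∈ p.support := by
    rintro z (hz | hz)
    · exact hz
    · simp only [Adj.toWalk, Walk.support_cons, Walk.support_nil, List.mem_cons,
        List.not_mem_nil, or_false] at hz
      rcases hz with rfl | rfl
      · exact p.end_mem_support
      · exact p.start_mem_support
  rcases hchord a (hsub a ha) b (hsub b hb) hab with h | h
  · exact hep h
  · exact heq (by rw [h, Sym2.eq_swap]; simp)

/-- In a minimal cutset, each vertex has a neighbor in every component of the complement. -/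
theorem exists_adj_of_minimal_isCutset {S : Set V}
    (hmin : ∀ S', S' ⊂ S → ¬ IsCutset G S') (C : (G.induce Sᶜ).ConnectedComponent) {s : V}
    (hs : s ∈ S) :
    ∃ x : (Sᶜ : Set V), (G.induce Sᶜ).connectedComponentMk x = C ∧ G.Adj x s := by
  by_contra! hcon
  have hsT : s ∈ (S \ {s})ᶜ := by simp
  refine hmin (S \ {s}) (Set.sdiff_singleton_ssubset.2 hs) ⟨⟨s, hsT⟩, fun hpre => ?_⟩
  obtain ⟨c, rfl⟩ := C.exists_rep
  obtain ⟨p⟩ := hpre ⟨c, fun h => c.2 h.1⟩ ⟨s, hsT⟩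
  obtain ⟨h, -⟩ := ConnectedComponent.mem_of_induce_walk _ (fun s' hs' hs'T x hx => by
    obtain rfl : s' = s := by_contra fun hne => hs'T ⟨hs', hne⟩
    exact hcon x hx) p ⟨c.2, rfl⟩
  exact h hs

theorem IsChordal.isClique_of_minimal_isCutset (hG : IsChordal G) {S : Set V} (hS : IsCutset G S)
    (hmin : ∀ S', S' ⊂ S → ¬ IsCutset G S') : G.IsClique S := by
  intro s hs t ht hst
  by_contra hadj
  have hpath : ∀ C : (G.induce Sᶜ).ConnectedComponent, ∃ p : G.Walk s t, p.IsPath ∧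
      (∀ z ∈ p.support, z = s ∨ z = t ∨ z ∈ Subtype.val '' C.supp) ∧
      (∀ a ∈ p.support, ∀ b ∈ p.support, G.Adj a b → s(a, b) ∈ p.edges ∨ s(a, b) = s(s, t)) ∧
      1 < p.length := by
    intro C
    obtain ⟨x, hx, hxs⟩ := exists_adj_of_minimal_isCutset hmin C hs
    obtain ⟨y, hy, hyt⟩ := exists_adj_of_minimal_isCutset hmin C ht
    obtain ⟨q, hq⟩ := ConnectedComponent.exists_walk_support hx hy
    have hdisj : ∀ z ∈ S, z ∉ Subtype.val '' C.supp := by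
      rintro _ hz ⟨w, -, rfl⟩
      exact w.2 hz
    exact exists_isPath_chord_eq hst q hq (hdisj s hs) (hdisj t ht) hxs.symm hyt
  obtain ⟨c, d, hcd⟩ : ∃ c d, ¬ (G.induce Sᶜ).Reachable c d := by
    simpa [Preconnected] using hS.2
  obtain ⟨p, hp, hpC, hpe, hpl⟩ := hpath ((G.induce Sᶜ).connectedComponentMk c)
  obtain ⟨q, hq, hqD, hqe, hql⟩ := hpath ((G.induce Sᶜ).connectedComponentMk d)
  obtain ⟨a, b, ha, hb, hab, hep, heq⟩ := hG.exists_chord_of_paths p q.reverse hp hq.reverse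
    (fun z hzp hzq => by
      rw [Walk.support_reverse, List.mem_reverse] at hzq
      rcases hpC z hzp with h | h | ⟨w, hw, rfl⟩
      · exact .inl h
      · exact .inr h
      rcases hqD _ hzq with h | h | ⟨w', hw', h⟩
      · exact .inl h
      · exact .inr h
      obtain rfl := Subtype.ext h
      exact absurd (ConnectedComponent.exact (hw.symm.trans hw')) hcd) hpl
    (by rw [Walk.length_reverse]; lia)
  simp only [Walk.support_reverse, List.mem_reverse, Walk.edges_reverse] at ha hb heq
  have hne : s(a, b) ≠ s(s, t) := fun h => hadj (by
    rwa [← G.mem_edgeSet, ← h, G.mem_edgeSet])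
  have hp' : ¬ (a ∈ p.support ∧ b ∈ p.support) := fun h =>
    (hpe a h.1 b h.2 hab).elim hep hne
  have hq' : ¬ (a ∈ q.support ∧ b ∈ q.support) := fun h =>
    (hqe a h.1 b h.2 hab).elim heq hne
  have cross : ∀ u v, u ∈ p.support → u ∉ q.support → v ∈ q.support → v ∉ p.support →
      ¬ G.Adj u v := by
    intro u v hu hu' hv hv' huv
    rcases hpC u hu with rfl | rfl | ⟨u, huC, rfl⟩
    · exact hu' q.start_mem_support
    · exact hu' q.end_mem_support
    rcases hqD v hv with rfl | rfl | ⟨v, hvD, rfl⟩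
    · exact hv' p.start_mem_support
    · exact hv' p.end_mem_support
    have huv' : (G.induce Sᶜ).Adj u v := huv
    exact hcd (ConnectedComponent.exact
      (huC.symm.trans ((ConnectedComponent.sound huv'.reachable).trans hvD)))
  have := cross a b
  have := cross b a
  have := hab.symm
  tauto

end Leafage

theorem stmt15 {V : Type*} [Fintype V] (G : SimpleGraph V) (hG : IsChordal G)
    (hc : G.Connected) (S : Set V) (hS : IsCutset G S)
    (hmin : ∀ S', S' ⊂ S → ¬ IsCutset G S') :
    ∀ C : (G.induce Sᶜ).ConnectedComponent, ∃ x : (Sᶜ : Set V),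
      (G.induce Sᶜ).connectedComponentMk x = C ∧ ∀ s ∈ S, G.Adj ↑x s := by
  intro C
  have hclique := hG.isClique_of_minimal_isCutset hS hmin
  have : Nonempty C.supp := C.nonempty_supp.to_subtype
  obtain ⟨⟨x, hx⟩, hmax⟩ :=
    Finite.exists_max fun x : C.supp => (G.neighborSet (x : (Sᶜ : Set V)) ∩ S).ncard
  refine ⟨x, hx, fun s hs => ?_⟩
  by_contra hxs
  obtain ⟨y₀, hy₀, hy₀s⟩ := exists_adj_of_minimal_isCutset hmin C hs
  obtain ⟨p, hp⟩ := ConnectedComponent.exists_walk_support hx hy₀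
  obtain ⟨y, q, hsy, hqp, hq⟩ := p.exists_walk_to_first (P := G.Adj s) hy₀s.symm
  obtain ⟨y, hy, rfl⟩ := hp y (hqp q.end_mem_support)
  have hqS : ∀ z ∈ S, z ∉ q.support := by
    intro z hz hzq
    obtain ⟨w, -, rfl⟩ := hp z (hqp hzq)
    exact w.2 hz
  refine (hmax ⟨y, hy⟩).not_gt (Set.ncard_lt_ncard ⟨fun t ht => ⟨?_, ht.2⟩, fun hsub => ?_⟩
    (Set.toFinite _))
  · have hst : s ≠ t := by
      rintro rfl
      exact hxs ht.1
    exact (hG.adj_of_walk_of_unique (hclique hs ht.2 hst) q (hqS s hs) (hqS t ht.2) hsy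
      (G.adj_symm ht.1) hq).symm
  · exact hxs (hsub ⟨hsy.symm, hs⟩).1
end

section
/- If G is a connected chordal graph other than a clique, then every modified extreme point of G is an extreme point of G. -/
open SimpleGraph

open SimpleGraph Leafage

namespace Leafage

/-- If two vertices of a walk are joined by an edge that the walk does not use, there is a strictly
shorter walk with the same ends on a subset of its vertices. -/
theorem exists_shorter_walk_of_chord {V : Type*} {G : SimpleGraph V} {u v s t : V}
    (p : G.Walk u v) (hs : s ∈ p.support) (ht : t ∈ p.support) (hst : G.Adj s t)
    (he : s(s, t) ∉ p.edges) :
    ∃ q : G.Walk u v, q.support ⊆ p.support ∧ q.length < p.length := by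
  rw [Walk.mem_support_iff_exists_getVert] at hs ht
  obtain ⟨i, rfl, hi⟩ := hs
  obtain ⟨j, rfl, hj⟩ := ht
  wlog hij : i ≤ j generalizing i j
  · exact this j hj i hi hst.symm (by rwa [Sym2.eq_swap]) (by omega)
  have hne : i ≠ j := by
    rintro rfl
    exact G.loopless.irrefl _ hst
  have hne' : j ≠ i + 1 := by
    rintro rfl
    refine he ?_
    rw [← Walk.mem_edges_toSubgraph, Subgraph.mem_edgeSet]
    exact p.toSubgraph_adj_getVert (by omega)
  refine ⟨(p.take i).append (Walk.cons hst (p.drop j)), fun w hw => ?_, ?_⟩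
  · rw [Walk.mem_support_append_iff, Walk.support_cons, List.mem_cons] at hw
    rcases hw with hw | rfl | hw
    · exact (p.isSubwalk_take i).support_subset hw
    · exact p.getVert_mem_support i
    · exact (p.isSubwalk_drop j).support_subset hw
  · rw [Walk.length_append, Walk.length_cons, Walk.take_length, Walk.drop_length]
    omega

/-- In a chordal graph, if the two ends of an edge are attached to the two ends of a walk that
avoids them, then some vertex of the walk is adjacent to both ends of the edge. -/
theorem IsChordal.exists_common_neighbor {V : Type*} {G : SimpleGraph V} (hG : IsChordal G)
    {x y : V} (hxy : G.Adj x y) {u v : V} (p : G.Walk u v) (hxu : G.Adj x u) (hyv : G.Adj y v)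
    (hx : x ∉ p.support) (hy : y ∉ p.support) :
    ∃ z ∈ p.support, G.Adj x z ∧ G.Adj y z := by
  classical
  induction hn : p.length using Nat.strong_induction_on generalizing u v with
  | _ n ih =>
  subst hn
  have shorten {u' v' : V} (q : G.Walk u' v') (hxu' : G.Adj x u') (hyv' : G.Adj y v')
      (hq : q.support ⊆ p.support) (hl : q.length < p.length) :
      ∃ z ∈ p.support, G.Adj x z ∧ G.Adj y z := by
    obtain ⟨z, hz, h⟩ := ih _ hl q hxu' hyv' (fun h => hx (hq h)) (fun h => hy (hq h)) rfl
    exact ⟨z, hq hz, h⟩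
  by_cases hp : p.IsPath
  swap
  · refine shorten p.bypass hxu hyv p.support_bypass_subset_support ?_
    by_contra! h
    exact hp (p.bypass_eq_self_of_length_le_length_bypass h ▸ p.bypass_isPath)
  by_cases hl : p.length = 0
  · obtain rfl := Walk.eq_of_length_eq_zero hl
    exact ⟨u, p.start_mem_support, hxu, hyv⟩
  have hu := p.start_mem_support
  have hv := p.end_mem_support
  have hcyc : (Walk.cons hxy.symm (Walk.cons hxu (p.concat hyv.symm))).IsCycle := by
    rw [Walk.cons_isCycle_iff]
    constructor
    · rw [Walk.cons_isPath_iff, Walk.concat_isPath_iff, Walk.support_concat]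
      simp [hp, hx, hy, hxy.ne]
    · have h₁ : s(y, x) ∉ p.edges := fun h => hy (p.fst_mem_support_of_mem_edges h)
      have h₂ : y ≠ u := fun h => hy (h ▸ hu)
      have h₃ : x ≠ v := fun h => hx (h ▸ hv)
      simp [Walk.edges_concat, h₁, h₂, h₃, hxy.ne, hxy.ne']
  obtain ⟨s, t, hs, ht, hst, he⟩ := hG _ _ hcyc (by simp; omega)
  simp only [Walk.support_cons, Walk.support_concat, Walk.edges_cons, Walk.edges_concat,
    List.mem_cons, List.mem_append, List.not_mem_nil, or_false, not_or] at hs ht he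
  obtain ⟨hyx, hxu', he⟩ := he
  simp only [List.concat_eq_append, List.mem_append, List.mem_singleton, not_or] at he
  obtain ⟨he, hvy⟩ := he
  have attach_x {w : V} (hw : w ∈ p.support) (hxw : G.Adj x w) (hne : s(x, w) ≠ s(x, u)) :
      ∃ z ∈ p.support, G.Adj x z ∧ G.Adj y z :=
    shorten (p.dropUntil w hw) hxw hyv (p.support_dropUntil_subset_support hw)
      (Walk.length_dropUntil_lt_length hw (by rintro rfl; exact hne rfl))
  have attach_y {w : V} (hw : w ∈ p.support) (hyw : G.Adj y w) (hne : s(y, w) ≠ s(v, y)) :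
      ∃ z ∈ p.support, G.Adj x z ∧ G.Adj y z :=
    shorten (p.takeUntil w hw) hxu hyw (p.support_takeUntil_subset_support hw)
      (Walk.length_takeUntil_lt_length hw (by rintro rfl; exact hne Sym2.eq_swap))
  have hs' : s = x ∨ s = y ∨ s ∈ p.support := by tauto
  have ht' : t = x ∨ t = y ∨ t ∈ p.support := by tauto
  rcases hs' with rfl | rfl | hs' <;> rcases ht' with rfl | rfl | ht'
  · exact absurd rfl hst.ne
  · exact absurd Sym2.eq_swap hyx
  · exact attach_x ht' hst hxu'
  · exact absurd rfl hyx
  · exact absurd rfl hst.ne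
  · exact attach_y ht' hst hvy
  · exact attach_x hs' hst.symm (by rwa [Sym2.eq_swap])
  · exact attach_y hs' hst.symm (by rwa [Sym2.eq_swap])
  · obtain ⟨q, hq, hlt⟩ := exists_shorter_walk_of_chord p hs' ht' hst he
    exact shorten q hxu hyv hq hlt

/-- A neighbor of a simplicial vertex `a` that is not equivalent to `a` has a neighbor outside
the closed neighborhood of `a`. -/
theorem IsSimplicial.exists_adj_notMem_closedNbhd {V : Type*} {G : SimpleGraph V} {a x : V}
    (ha : IsSimplicial G a) (hx : G.Adj a x) (hne : ¬ EquivVerts G x a) :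
    ∃ z, z ∉ closedNbhd G a ∧ G.Adj x z := by
  by_contra! h
  refine hne (Set.Subset.antisymm ?_ ?_)
  · rintro w (rfl | hw)
    · exact Or.inr hx
    · by_contra hwa
      exact h w hwa hw
  · rintro w (rfl | hw)
    · exact Or.inr hx.symm
    · by_cases hxw : w = x
      · exact Or.inl hxw
      · exact Or.inr (ha hx hw (Ne.symm hxw))

end Leafage

theorem stmt16 {V : Type*} [Fintype V] (G : SimpleGraph V) (hG : IsChordal G)
    (hc : G.Connected) (hnc : G ≠ ⊤) (a : V) (ha : IsMEP G a) : IsEP G a := by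
  obtain ⟨hs, hb⟩ := ha
  refine ⟨hs, fun x hx y hy hxy hxa hya => ?_⟩
  obtain ⟨x', hx', hxx'⟩ := hs.exists_adj_notMem_closedNbhd hx hxa
  obtain ⟨y', hy', hyy'⟩ := hs.exists_adj_notMem_closedNbhd hy hya
  let H := G.induce (closedNbhd G a)ᶜ
  have hyb : y ∈ compBoundary G a (H.connectedComponentMk ⟨y', hy'⟩) :=
    ⟨Or.inr hy, ⟨y', hy'⟩, rfl, hyy'⟩
  rw [hb _ (H.connectedComponentMk ⟨x', hx'⟩)] at hyb
  obtain ⟨-, w, hw, hyw⟩ := hyb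
  obtain ⟨q⟩ := (ConnectedComponent.exact hw).symm
  have hq : ∀ z ∈ (q.map (Embedding.induce (closedNbhd G a)ᶜ).toHom).support,
      z ∉ closedNbhd G a := by
    intro z hz
    rw [Walk.support_map, List.mem_map] at hz
    obtain ⟨z, -, rfl⟩ := hz
    exact z.2
  obtain ⟨z, hz, hxz, hyz⟩ := hG.exists_common_neighbor (hs hx hy hxy)
    (q.map (Embedding.induce (closedNbhd G a)ᶜ).toHom) hxx' hyw
    (fun h => hq x h (Or.inr hx)) (fun h => hq y h (Or.inr hy))
  exact ⟨z, hq z hz, hxz, hyz⟩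
end

section
/- If G is a connected chordal graph that is not a clique and H is a connected reduced induced subgraph of G, then the proper leafage l*(G) is at least the number of modified extreme points of H. -/
open SimpleGraph

open SimpleGraph Leafage

namespace Leafage

/-- `u` and `v` are joined by a walk of `T` avoiding the vertex `p`. -/
def JoinedOff {β : Type*} (T : SimpleGraph β) (p u v : β) : Prop :=
  ∃ w : T.Walk u v, p ∉ w.support

section JoinedOff

variable {β : Type*} {T : SimpleGraph β} {p u v w : β}

lemma JoinedOff.symm (h : JoinedOff T p u v) : JoinedOff T p v u := by
  obtain ⟨q, hq⟩ := h
  exact ⟨q.reverse, by simpa using hq⟩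

lemma JoinedOff.trans (h : JoinedOff T p u v) (h' : JoinedOff T p v w) : JoinedOff T p u w := by
  obtain ⟨q, hq⟩ := h
  obtain ⟨r, hr⟩ := h'
  exact ⟨q.append r, by simp [Walk.mem_support_append_iff, hq, hr]⟩

lemma JoinedOff.cons (h : JoinedOff T p u v) (hw : T.Adj w u) (hp : p ≠ w) :
    JoinedOff T p w v := by
  obtain ⟨q, hq⟩ := h
  exact ⟨.cons hw q, by simp [hp, hq]⟩

lemma IsSubtree.joinedOff {S : Set β} (hS : IsSubtree T S) (hp : p ∉ S) (hu : u ∈ S)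
    (hv : v ∈ S) : JoinedOff T p u v := by
  obtain ⟨q⟩ := hS.preconnected ⟨u, hu⟩ ⟨v, hv⟩
  have aux {x y : S} (q : (T.induce S).Walk x y) : JoinedOff T p x y := by
    induction q with
    | @nil x => exact ⟨.nil, by simpa using fun h : p = x => hp (h ▸ x.2)⟩
    | @cons x _ _ hadj _ ih => exact ih.cons hadj fun h => hp (h ▸ x.2)
  exact aux q

/-- In an acyclic graph, distinct neighbours of `p` are separated by `p`. -/
lemma JoinedOff.eq_of_adj (hT : T.IsAcyclic) (hu : T.Adj p u) (hv : T.Adj p v)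
    (h : JoinedOff T p u v) : u = v := by
  classical
  obtain ⟨q, hq⟩ := h
  have hp : (Walk.cons hu q.bypass).IsPath :=
    (Walk.cons_isPath_iff hu _).2 ⟨q.bypass_isPath, fun h => hq (q.support_bypass_subset_support h)⟩
  have := congrArg (fun r : T.Path p v => r.1.length)
    ((hT.subsingleton_path p v).elim ⟨_, hp⟩ ⟨hv.toWalk, .of_adj hv⟩)
  simp only [Walk.length_cons, Walk.length_nil, Adj.toWalk] at this
  exact Walk.eq_of_length_eq_zero (p := q.bypass) (by lia)

end JoinedOff

/-- If no `p k` separates two other `p i`, then each `p k` has a leaf of the tree on its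
private side. -/
lemma exists_isLeaf_not_joinedOff {β ι : Type*} [Finite β] [Nontrivial β] {T : SimpleGraph β}
    (hT : T.IsTree) (p : ι → β) (k : ι)
    (h : ∀ i j, i ≠ k → j ≠ k → JoinedOff T (p k) (p i) (p j)) :
    ∃ y, IsLeaf T y ∧ ∀ i, i ≠ k → ¬ JoinedOff T (p k) y (p i) := by
  classical
  obtain ⟨y, hy, hmax⟩ := Set.exists_max_image
    {y | ∀ i, i ≠ k → ¬ JoinedOff T (p k) y (p i)} (fun y => T.dist (p k) y) (Set.toFinite _)
    ⟨p k, fun i _ ⟨w, hw⟩ => hw w.start_mem_support⟩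
  refine ⟨y, ?_, hy⟩
  obtain ⟨z, hz⟩ := hT.connected.preconnected.exists_adj_of_nontrivial y
  refine Set.ncard_eq_one.2 ⟨z, Set.eq_singleton_iff_unique_mem.2 ⟨hz, fun z' hz' => ?_⟩⟩
  replace hz' : T.Adj y z' := hz'
  by_cases hyk : y = p k
  · subst hyk
    have key : ∀ x, T.Adj (p k) x → ∃ i, i ≠ k ∧ JoinedOff T (p k) x (p i) := by
      intro x hx
      by_contra! hcon
      have := hmax x hcon
      rw [dist_eq_one_iff_adj.2 hx, dist_self] at this
      lia
    obtain ⟨i, hi, hzi⟩ := key z hz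
    obtain ⟨j, hj, hzj⟩ := key z' hz'
    exact (hzj.trans ((h j i hj hi).trans hzi.symm)).eq_of_adj hT.isAcyclic hz' hz
  · have key : ∀ x, T.Adj y x → JoinedOff T y x (p k) := by
      intro x hx
      have hle := hmax x fun i hi hj => hy i hi (hj.cons hx (Ne.symm hyk))
      obtain ⟨w, hw⟩ := hT.connected.exists_walk_length_eq_dist x (p k)
      refine ⟨w, fun hyw => ?_⟩
      have h1 := dist_le (w.dropUntil y hyw)
      have h2 := w.length_dropUntil_le_length hyw
      have h3 := hT.dist_eq_dist_add_one_of_adj (p k) hx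
      rw [dist_comm] at hw h1
      lia
    exact ((key z' hz').trans (key z hz).symm).eq_of_adj hT.isAcyclic hz' hz

/-- A finite nontrivial tree has at least as many leaves as any family of nodes none of which
separates two others. -/
lemma card_le_numLeaves {β ι : Type*} [Finite β] [Nontrivial β] {T : SimpleGraph β}
    (hT : T.IsTree) (p : ι → β) (hp : Function.Injective p)
    (h : ∀ k i j, i ≠ k → j ≠ k → JoinedOff T (p k) (p i) (p j)) :
    Nat.card ι ≤ numLeaves T := by
  classical
  choose l hl hl' using fun k => exists_isLeaf_not_joinedOff hT p k (h k)
  refine Nat.card_le_card_of_injective (fun k => (⟨l k, hl k⟩ : {v | IsLeaf T v})) ?_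
  intro k k' hkk
  by_contra hne
  have hll : l k = l k' := congrArg Subtype.val hkk
  obtain ⟨w⟩ := hT.connected.preconnected (l k) (p k)
  have h1 : p k' ∈ w.bypass.support := by
    by_contra hc
    exact hl' k' k hne (hll ▸ ⟨w.bypass, hc⟩)
  exact hl' k k' (Ne.symm hne) ⟨w.bypass.takeUntil _ h1,
    Walk.endpoint_notMem_support_takeUntil w.bypass_isPath h1 (hp.ne hne)⟩

/-- In a connected graph, the boundary of every component of `H - N[a]` is nonempty. -/
lemma exists_mem_compBoundary {α : Type*} {H : SimpleGraph α} (hH : H.Connected) {a : α}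
    (C : (H.induce (closedNbhd H a)ᶜ).ConnectedComponent) : ∃ x, x ∈ compBoundary H a C := by
  induction C using ConnectedComponent.ind with | _ i => ?_
  obtain ⟨w⟩ := hH.preconnected i a
  obtain ⟨d, -, ⟨h, hC, hd⟩, hsnd⟩ := w.exists_boundary_dart
    {x | ∃ h : ((closedNbhd H a)ᶜ : Set α), (H.induce (closedNbhd H a)ᶜ).connectedComponentMk h =
      (H.induce (closedNbhd H a)ᶜ).connectedComponentMk i ∧ ↑h = x} ⟨i, rfl, rfl⟩
    (fun ⟨h, _, ha⟩ => h.2 (Or.inl ha))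
  refine ⟨d.snd, ?_, h, hC, hd ▸ d.adj.symm⟩
  by_contra hN
  refine hsnd ⟨⟨d.snd, hN⟩, hC ▸ ConnectedComponent.sound (Adj.reachable ?_), rfl⟩
  have hadj : H.Adj d.snd h := hd ▸ d.adj.symm
  exact hadj

/-- In a subtree representation, subtrees of vertices in the same component of `H - N[a]` lie on
the same side of any node of the subtree of `a`. -/
lemma IsSubtreeRep.joinedOff_of_reachable {α β : Type*} {H : SimpleGraph α} {T : SimpleGraph β}
    {f : α → Set β} (hf : IsSubtreeRep H T f) {a : α} {p : β} (hp : p ∈ f a)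
    {i j : ((closedNbhd H a)ᶜ : Set α)} (hij : (H.induce (closedNbhd H a)ᶜ).Reachable i j) :
    ∀ u ∈ f i, ∀ v ∈ f j, JoinedOff T p u v := by
  have hout (i : ((closedNbhd H a)ᶜ : Set α)) : p ∉ f i := fun hpi =>
    i.2 (Or.inr ((hf.2 a i fun h => i.2 (Or.inl h.symm)).2 ⟨p, hp, hpi⟩))
  obtain ⟨w⟩ := hij
  induction w with
  | nil => exact fun u hu v hv => (hf.1 _).joinedOff (hout _) hu hv
  | @cons i h j hih w ih =>
    intro u hu v hv
    obtain ⟨x, hxi, hxh⟩ := (hf.2 i h (Adj.ne hih)).1 hih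
    exact ((hf.1 _).joinedOff (hout _) hu hxi).trans (ih x hxh v hv)

/-- In a proper subtree representation, the subtree of a modified extreme point `a` has a node
that separates no two subtrees of vertices outside `N[a]`. -/
lemma IsMEP.exists_node {α β : Type*} {H : SimpleGraph α} (hH : H.Connected)
    {T : SimpleGraph β} {f : α → Set β} (hf : IsProperSubtreeRep H T f) {a : α}
    (ha : IsMEP H a) :
    ∃ p ∈ f a, ∀ i j, i ∉ closedNbhd H a → j ∉ closedNbhd H a →
      ∀ u ∈ f i, ∀ v ∈ f j, JoinedOff T p u v := by
  obtain ⟨hrep, hproper⟩ := hf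
  by_cases hN : ∃ b, b ∉ closedNbhd H a
  swap
  · obtain ⟨p, hp⟩ := (hrep.1 a).nonempty
    exact ⟨p, hp, fun i j hi => (hN ⟨i, hi⟩).elim⟩
  obtain ⟨b, hb⟩ := hN
  set C₀ := (H.induce (closedNbhd H a)ᶜ).connectedComponentMk ⟨b, hb⟩
  obtain ⟨x, hx⟩ := exists_mem_compBoundary hH C₀
  obtain ⟨h, -, hxh⟩ := hx.2
  have hxa : a ≠ x := by
    rintro rfl
    exact h.2 (Or.inr hxh)
  have hsub : ¬ f a ⊆ f x := by
    intro hle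
    have heq : f a = f x := by
      by_contra hne
      exact hproper a x hxa (hle.ssubset_of_ne hne)
    refine h.2 (Or.inr ((hrep.2 a h fun e => h.2 (Or.inl e.symm)).2 ?_))
    rw [heq]
    exact (hrep.2 x h (Adj.ne hxh)).1 hxh
  obtain ⟨p, hpa, hpx⟩ := Set.not_subset.1 hsub
  have key (i) (hi : i ∉ closedNbhd H a) : ∃ y ∈ f x, ∀ u ∈ f i, JoinedOff T p u y := by
    have hxi : x ∈ compBoundary H a ((H.induce (closedNbhd H a)ᶜ).connectedComponentMk ⟨i, hi⟩) :=
      ha.2 C₀ _ ▸ hx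
    obtain ⟨-, h, hC, hxh⟩ := hxi
    obtain ⟨y, hyx, hyh⟩ := (hrep.2 x h (Adj.ne hxh)).1 hxh
    exact ⟨y, hyx, fun u hu =>
      hrep.joinedOff_of_reachable hpa (ConnectedComponent.exact hC).symm u hu y hyh⟩
  refine ⟨p, hpa, fun i j hi hj u hu v hv => ?_⟩
  obtain ⟨y, hy, hiy⟩ := key i hi
  obtain ⟨z, hz, hjz⟩ := key j hj
  exact (hiy u hu).trans (((hrep.1 x).joinedOff hpx hy hz).trans (hjz v hv).symm)

/-- Adjacent simplicial vertices are equivalent. -/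
lemma IsSimplicial.equivVerts {α : Type*} {H : SimpleGraph α} {a b : α} (ha : IsSimplicial H a)
    (hb : IsSimplicial H b) (hab : H.Adj a b) : EquivVerts H a b := by
  have aux {a b : α} (ha : IsSimplicial H a) (hab : H.Adj a b) :
      closedNbhd H a ⊆ closedNbhd H b := by
    rintro x (rfl | hx)
    · exact Or.inr hab.symm
    · by_cases hxb : x = b
      · exact Or.inl hxb
      · exact Or.inr (ha hab hx (Ne.symm hxb))
  exact (aux ha hab).antisymm (aux hb hab.symm)

lemma ncard_isMEP_le_numLeaves {α β : Type*} [Finite β] [Nontrivial β] {H : SimpleGraph α}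
    (hH : H.Connected) (hred : IsReduced H) {T : SimpleGraph β} (hT : T.IsTree)
    {f : α → Set β} (hf : IsProperSubtreeRep H T f) :
    {a | IsMEP H a}.ncard ≤ numLeaves T := by
  have hout {a b : α} (ha : IsMEP H a) (hb : IsMEP H b) (hab : a ≠ b) :
      b ∉ closedNbhd H a := by
    rintro (h | h)
    · exact hab h.symm
    · exact hab (hred _ _ (ha.1.equivVerts hb.1 h))
  choose p hp hsep using fun a : {a | IsMEP H a} => a.2.exists_node hH hf
  refine card_le_numLeaves hT p (fun a b hab => ?_) fun k i j hi hj => hsep k i j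
    (hout k.2 i.2 fun h => hi (Subtype.ext h.symm)) (hout k.2 j.2 fun h => hj (Subtype.ext h.symm))
    _ (hp i) _ (hp j)
  by_contra hne
  have hne' : (a : α) ≠ b := fun h => hne (Subtype.ext h)
  exact hout a.2 b.2 hne' (Or.inr ((hf.1.2 a b hne').2 ⟨p a, hp a, hab ▸ hp b⟩))

end Leafage

namespace Leafage

/-- A walk of minimal length has no chord. -/
lemma mem_edges_of_length_eq_dist {α : Type*} {K : SimpleGraph α} {x y : α} {p : K.Walk x y}
    (hp : p.length = K.dist x y) {a b : α} (ha : a ∈ p.support) (hb : b ∈ p.support)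
    (hab : K.Adj a b) : s(a, b) ∈ p.edges := by
  obtain ⟨i, rfl, hi⟩ := Walk.mem_support_iff_exists_getVert.1 ha
  obtain ⟨j, rfl, hj⟩ := Walk.mem_support_iff_exists_getVert.1 hb
  wlog hij : i ≤ j generalizing i j
  · rw [Sym2.eq_swap]
    exact this j hj hb i hi ha hab.symm (by lia)
  have hle := dist_le ((p.take i).append (.cons hab (p.drop j)))
  rw [Walk.length_append, Walk.length_cons, Walk.take_length, Walk.drop_length] at hle
  have hne : i ≠ j := by
    rintro rfl
    exact hab.ne rfl
  obtain rfl : j = i + 1 := by lia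
  exact Walk.adj_toSubgraph_iff_mem_edges.1 (p.toSubgraph_adj_getVert (by lia))

lemma exists_chordless_isPath {α α' : Type*} {K : SimpleGraph α} {G : SimpleGraph α'}
    (φ : K ↪g G) {x y : α} (h : K.Reachable x y) :
    ∃ q : G.Walk (φ x) (φ y), q.IsPath ∧ (∀ u ∈ q.support, u ∈ Set.range φ) ∧
      ∀ a b, a ∈ q.support → b ∈ q.support → G.Adj a b → s(a, b) ∈ q.edges := by
  obtain ⟨p, hp⟩ := h.exists_walk_length_eq_dist
  refine ⟨p.map φ.toHom, (p.isPath_of_length_eq_dist hp).map φ.injective, ?_, ?_⟩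
  · intro u hu
    rw [Walk.support_map, List.mem_map] at hu
    obtain ⟨x, -, rfl⟩ := hu
    exact ⟨x, rfl⟩
  · intro a b ha hb hab
    rw [Walk.support_map, List.mem_map] at ha hb
    obtain ⟨a, ha, rfl⟩ := ha
    obtain ⟨b, hb, rfl⟩ := hb
    rw [Walk.edges_map, List.mem_map]
    exact ⟨_, mem_edges_of_length_eq_dist hp ha hb (φ.map_adj_iff.1 hab), rfl⟩

/-- In a chordal graph, two neighbours of `v` that both see a connected set avoiding `N[v]`
are adjacent. -/
lemma IsChordal.adj_of_preconnected {V : Type*} {G : SimpleGraph V} (hG : IsChordal G)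
    {v x y : V} {C : Set V} (hvx : G.Adj v x) (hvy : G.Adj v y)
    (hC : ∀ c ∈ C, c ≠ v ∧ ¬ G.Adj v c) (hconn : (G.induce C).Preconnected)
    (hx : ∃ c ∈ C, G.Adj x c) (hy : ∃ c ∈ C, G.Adj y c) (hxy : x ≠ y) : G.Adj x y := by
  by_contra hnadj
  obtain ⟨c, hc, hxc⟩ := hx
  obtain ⟨d, hd, hyd⟩ := hy
  have hD : (G.induce ({x} ∪ (C ∪ {y}))).Preconnected :=
    (connected_induce_union Preconnected.of_subsingleton
      (connected_induce_union hconn Preconnected.of_subsingleton hd (Set.mem_singleton y)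
        hyd.symm).preconnected
      (Set.mem_singleton x) (Or.inl hc) hxc).preconnected
  obtain ⟨q, hq, hqD, hchord⟩ : ∃ q : G.Walk x y, q.IsPath ∧
      (∀ u ∈ q.support, u ∈ Set.range (Embedding.induce (G := G) ({x} ∪ (C ∪ {y})))) ∧
      ∀ a b, a ∈ q.support → b ∈ q.support → G.Adj a b → s(a, b) ∈ q.edges :=
    exists_chordless_isPath (Embedding.induce ({x} ∪ (C ∪ {y})))
      (hD ⟨x, Or.inl rfl⟩ ⟨y, Or.inr (Or.inr rfl)⟩)
  replace hqD : ∀ u ∈ q.support, u = x ∨ u ∈ C ∨ u = y := by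
    intro u hu
    obtain ⟨z, rfl⟩ := hqD u hu
    exact z.2
  have hvq : v ∉ q.support := by
    intro h
    rcases hqD v h with rfl | h | rfl
    · exact hvx.ne rfl
    · exact (hC v h).1 rfl
    · exact hvy.ne rfl
  have hcyc : (Walk.cons hvx (q.concat hvy.symm)).IsCycle := by
    refine (Walk.cons_isCycle_iff _ _).2 ⟨hq.concat hvq hvy.symm, ?_⟩
    rw [Walk.edges_concat, List.concat_eq_append, List.mem_append, List.mem_singleton]
    rintro (h | h)
    · exact hvq (q.fst_mem_support_of_mem_edges h)
    · rcases Sym2.eq_iff.1 h with ⟨h, -⟩ | ⟨-, h⟩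
      · exact hvy.ne h
      · exact hxy h
  have hlen : 2 ≤ q.length := by
    by_contra! hlt
    interval_cases h : q.length
    · exact hxy (Walk.eq_of_length_eq_zero h)
    · exact hnadj (Walk.adj_of_length_eq_one h)
  have hv (b : V) (hb : b ∈ q.support) (hvb : G.Adj v b) :
      s(v, b) ∈ (Walk.cons hvx (q.concat hvy.symm)).edges := by
    rw [Walk.edges_cons, Walk.edges_concat]
    rcases hqD b hb with rfl | h | rfl
    · simp
    · exact ((hC b h).2 hvb).elim
    · simp [Sym2.eq_swap]
  obtain ⟨a, b, ha, hb, hab, hnot⟩ := hG v _ hcyc (by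
    rw [Walk.length_cons, Walk.length_concat]; lia)
  have hsupp (a : V) (ha : a ∈ (Walk.cons hvx (q.concat hvy.symm)).support) :
      a = v ∨ a ∈ q.support := by
    rw [Walk.support_cons, Walk.support_concat] at ha
    simp only [List.mem_cons, List.mem_append, List.not_mem_nil, or_false] at ha
    tauto
  rcases hsupp a ha with rfl | ha' <;> rcases hsupp b hb with rfl | hb'
  · exact hab.ne rfl
  · exact hnot (hv b hb' hab)
  · exact hnot (Sym2.eq_swap ▸ hv a ha' hab.symm)
  · refine hnot ?_
    rw [Walk.edges_cons, Walk.edges_concat]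
    simp [hchord a b ha' hb' hab]

/-- Dirac's lemma, relative to a vertex set `U`: off any vertex `v` not universal in `U` there is
a vertex that is simplicial in `U`. -/
lemma IsChordal.exists_simplicial_not_adj {V : Type*} [Finite V] {G : SimpleGraph V}
    (hG : IsChordal G) (U : Set V) : ∀ v ∈ U, ∀ u ∈ U, u ≠ v → ¬ G.Adj v u →
      ∃ w ∈ U, w ≠ v ∧ ¬ G.Adj v w ∧ G.IsClique (G.neighborSet w ∩ U) := by
  induction U using WellFoundedLT.induction with | _ U ih => ?_
  intro v hv u hu huv hnadj
  obtain ⟨C, -, ⟨huC, hCB, hCconn⟩, hCmax⟩ := Finite.exists_le_maximal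
    (p := fun C : Set V => u ∈ C ∧ C ⊆ {b ∈ U | b ≠ v ∧ ¬ G.Adj v b} ∧ (G.induce C).Preconnected)
    (a := {u}) ⟨rfl, by simp [hu, huv, hnadj], Preconnected.of_subsingleton⟩
  have hclosed {c b : V} (hc : c ∈ C) (hb : b ∈ U) (hbv : b ≠ v) (hvb : ¬ G.Adj v b)
      (hcb : G.Adj c b) : b ∈ C :=
    hCmax ⟨Or.inl huC, Set.union_subset hCB (Set.singleton_subset_iff.2 ⟨hb, hbv, hvb⟩),
      (connected_induce_union hCconn Preconnected.of_subsingleton hc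
        (Set.mem_singleton b) hcb).preconnected⟩ Set.subset_union_left (Or.inr rfl)
  set S : Set V := {s ∈ U | G.Adj v s ∧ ∃ c ∈ C, G.Adj s c}
  have hS : G.IsClique S := fun x hx y hy hxy =>
    hG.adj_of_preconnected hx.2.1 hy.2.1 (fun c hc => (hCB hc).2) hCconn hx.2.2 hy.2.2 hxy
  have hsub : C ∪ S ⊆ U := Set.union_subset (fun c hc => (hCB hc).1) fun s hs => hs.1
  have hlt : C ∪ S < U := by
    refine (Set.ssubset_iff_of_subset hsub).2 ⟨v, hv, ?_⟩
    rintro (h | h)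
    · exact (hCB h).2.1 rfl
    · exact h.2.1.ne rfl
  have hnbr {c z : V} (hc : c ∈ C) (hz : z ∈ U) (hcz : G.Adj c z) : z ∈ C ∪ S := by
    by_cases hzv : z = v
    · exact ((hCB hc).2.2 (hzv ▸ hcz.symm)).elim
    by_cases hvz : G.Adj v z
    · exact Or.inr ⟨hz, hvz, c, hc, hcz.symm⟩
    · exact Or.inl (hclosed hc hz hzv hvz hcz)
  suffices h : ∃ w ∈ C, G.IsClique (G.neighborSet w ∩ (C ∪ S)) by
    obtain ⟨w, hw, hcl⟩ := h
    exact ⟨w, (hCB hw).1, (hCB hw).2.1, (hCB hw).2.2,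
      IsClique.subset (fun z hz => And.intro hz.1 (hnbr hw hz.2 hz.1)) hcl⟩
  by_cases hex : ∃ s ∈ S, ∃ b ∈ C ∪ S, b ≠ s ∧ ¬ G.Adj s b
  · obtain ⟨s, hs, b, hb, hbs, hsb⟩ := hex
    obtain ⟨w, hw, hws, hsw, hcl⟩ := ih _ hlt s (Or.inr hs) b hb hbs hsb
    exact ⟨w, hw.resolve_right fun h => hsw (hS hs h hws.symm), hcl⟩
  push Not at hex
  by_cases hcl : G.IsClique (C ∪ S)
  · exact ⟨u, huC, hcl.subset Set.inter_subset_right⟩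
  simp only [isClique_iff, Set.Pairwise, not_forall] at hcl
  obtain ⟨a, ha, b, hb, hab, hnab⟩ := hcl
  obtain ⟨w, hw, hwa, haw, hcl⟩ := ih _ hlt a ha b hb hab.symm hnab
  exact ⟨w, hw.resolve_right fun h => haw (hex w h a ha hwa.symm).symm, hcl⟩

lemma IsChordal.exists_simplicial {V : Type*} [Finite V] {G : SimpleGraph V}
    (hG : IsChordal G) {U : Set V} (hU : U.Nonempty) :
    ∃ w ∈ U, G.IsClique (G.neighborSet w ∩ U) := by
  by_cases hcl : G.IsClique U
  · obtain ⟨u, hu⟩ := hU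
    exact ⟨u, hu, hcl.subset Set.inter_subset_right⟩
  simp only [isClique_iff, Set.Pairwise, not_forall] at hcl
  obtain ⟨a, ha, b, hb, hab, hnab⟩ := hcl
  obtain ⟨w, hw, -, -, h⟩ := hG.exists_simplicial_not_adj U a ha b hb hab.symm hnab
  exact ⟨w, hw, h⟩

/-- Attach a new leaf `none` to the vertex `x`. -/
def addLeaf {β : Type*} (T : SimpleGraph β) (x : β) : SimpleGraph (Option β) :=
  T.map Function.Embedding.some ⊔ edge none (some x)

section addLeaf

variable {β β' : Type*} {T : SimpleGraph β} {T' : SimpleGraph β'} {x : β} {S : Set β}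

lemma IsSubtree.image (φ : T →g T') (hS : IsSubtree T S) : IsSubtree T' (φ '' S) := by
  refine Connected.map (G := T.induce S)
    ⟨fun s => ⟨φ s, s, s.2, rfl⟩, fun {a b} h => φ.map_adj h⟩ ?_ hS
  rintro ⟨-, s, hs, rfl⟩
  exact ⟨⟨s, hs⟩, rfl⟩

/-- The inclusion of a graph in the graph with a leaf attached. -/
def someHom (T : SimpleGraph β) (x : β) : T →g addLeaf T x :=
  ⟨some, fun h => Or.inl ((map_adj_apply (f := Function.Embedding.some)).2 h)⟩

lemma addLeaf_adj_none (T : SimpleGraph β) (x : β) : (addLeaf T x).Adj (some x) none :=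
  Or.inr (by simp [edge_adj])

lemma isSubtree_singleton (T : SimpleGraph β) (x : β) : IsSubtree T {x} :=
  { preconnected := Preconnected.of_subsingleton, nonempty := ⟨⟨x, rfl⟩⟩ }

lemma IsSubtree.image_some (hS : IsSubtree T S) : IsSubtree (addLeaf T x) (some '' S) :=
  hS.image (someHom T x)

lemma IsSubtree.insert_none (hS : IsSubtree T S) (hx : x ∈ S) :
    IsSubtree (addLeaf T x) (insert none (some '' S)) := by
  rw [Set.insert_eq, Set.union_comm]
  exact connected_induce_union (hS.image_some (x := x)).preconnected
    Preconnected.of_subsingleton ⟨x, hx, rfl⟩ rfl (addLeaf_adj_none T x)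

lemma addLeaf_isTree [Finite β] (hT : T.IsTree) (x : β) : (addLeaf T x).IsTree := by
  obtain ⟨hconn, hcard⟩ := isTree_iff_connected_and_card.1 hT
  refine isTree_iff_connected_and_card.2 ⟨?_, ?_⟩
  · have huniv : IsSubtree T Set.univ := (induceUnivIso T).connected_iff.2 hconn
    have := huniv.insert_none (Set.mem_univ x)
    rw [Set.image_univ, Set.insert_none_range_some] at this
    exact (induceUnivIso _).connected_iff.1 this
  · rw [Finite.card_option, ← hcard, addLeaf, edgeSet_sup, edgeSet_map,
      edgeSet_edge_of_ne (by simp), Set.union_singleton, Nat.card_coe_set_eq,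
      Set.ncard_insert_of_notMem _ (Set.toFinite _),
      Set.ncard_image_of_injective _ (Function.Embedding.injective _), Nat.card_coe_set_eq]
    rintro ⟨e, -, he⟩
    have : none ∈ Sym2.map some e := by
      rw [show Sym2.map some e = s(none, some x) from he]
      simp
    simp at this

end addLeaf

/-- A chordal graph has a subtree representation in which every clique has a common node and
every subtree has a private node. -/
lemma IsChordal.exists_rep {V : Type*} [Finite V] {G : SimpleGraph V} (hG : IsChordal G)
    (U : Set V) : ∃ (β : Type) (_ : Finite β) (T : SimpleGraph β) (f : V → Set β), T.IsTree ∧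
      (∀ u ∈ U, IsSubtree T (f u)) ∧
      (∀ u ∈ U, ∀ v ∈ U, u ≠ v → (G.Adj u v ↔ (f u ∩ f v).Nonempty)) ∧
      (∀ u ∈ U, ∃ p ∈ f u, ∀ v ∈ U, v ≠ u → p ∉ f v) ∧
      ∀ K ⊆ U, G.IsClique K → ∃ x, ∀ u ∈ K, x ∈ f u := by
  classical
  induction U using WellFoundedLT.induction with | _ U ih => ?_
  rcases U.eq_empty_or_nonempty with rfl | hU
  · refine ⟨Unit, inferInstance, ⊥, fun _ => ∅, .of_subsingleton, by simp, by simp, by simp, ?_⟩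
    intro K hK _
    exact ⟨(), fun u hu => (hK hu).elim⟩
  obtain ⟨w, hw, hcl⟩ := hG.exists_simplicial hU
  obtain ⟨β, _, T, f, hT, hsub, hadj, hpriv, hclq⟩ := ih (U \ {w})
    ((Set.ssubset_iff_of_subset Set.sdiff_subset).2 ⟨w, hw, fun h => h.2 rfl⟩)
  obtain ⟨x, hx⟩ := hclq (G.neighborSet w ∩ U)
    (fun u hu => ⟨hu.2, fun h => hu.1.ne (Set.mem_singleton_iff.1 h).symm⟩) hcl
  let f₁ : V → Set (Option β) := fun u =>
    if G.Adj w u then insert none (some '' f u) else some '' f u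
  let f₂ : V → Set (Option (Option β)) := fun u =>
    if u = w then insert none (some '' {none}) else some '' f₁ u
  have hf₁some (u : V) (b : β) : some b ∈ f₁ u ↔ b ∈ f u := by
    by_cases h : G.Adj w u <;> simp [f₁, h]
  have hf₁none (u : V) : none ∈ f₁ u ↔ G.Adj w u := by
    by_cases h : G.Adj w u <;> simp [f₁, h]
  have hf₂w : f₂ w = {none, some none} := by simp [f₂]
  have hf₂ {u : V} (hu : u ≠ w) : f₂ u = some '' f₁ u := if_neg hu
  have hmem {u : V} (hu : u ≠ w) (b : β) : some (some b) ∈ f₂ u ↔ b ∈ f u := by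
    simp [hf₂ hu, hf₁some]
  have hmemnone {u : V} (hu : u ≠ w) : some none ∈ f₂ u ↔ G.Adj w u := by
    simp [hf₂ hu, hf₁none]
  have hwadj {u : V} (hu : u ≠ w) : G.Adj w u ↔ (f₂ w ∩ f₂ u).Nonempty := by
    rw [← hmemnone hu, hf₂w]
    refine ⟨fun h => ⟨_, by simp, h⟩, ?_⟩
    rintro ⟨y, rfl | rfl, hy⟩
    · simp [hf₂ hu] at hy
    · exact hy
  refine ⟨Option (Option β), inferInstance, addLeaf (addLeaf T x) none, f₂,
    addLeaf_isTree (addLeaf_isTree hT x) none, ?_, ?_, ?_, ?_⟩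
  · intro u hu
    by_cases huw : u = w
    · simp only [f₂, huw, if_true]
      exact (isSubtree_singleton _ none).insert_none rfl
    · rw [hf₂ huw]
      refine IsSubtree.image_some ?_
      have hs := hsub u ⟨hu, huw⟩
      by_cases h : G.Adj w u
      · simp only [f₁, h, if_true]
        exact hs.insert_none (hx u ⟨h, hu⟩)
      · simp only [f₁, h, if_false]
        exact hs.image_some
  · intro u hu v hv huv
    by_cases huw : u = w
    · subst huw
      exact hwadj huv.symm
    by_cases hvw : v = w
    · subst hvw
      rw [adj_comm, Set.inter_comm]
      exact hwadj huw
    rw [hadj u ⟨hu, huw⟩ v ⟨hv, hvw⟩ huv]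
    constructor
    · rintro ⟨b, hb, hb'⟩
      exact ⟨some (some b), (hmem huw b).2 hb, (hmem hvw b).2 hb'⟩
    · rintro ⟨_ | _ | b, hb, hb'⟩
      · simp [hf₂ huw] at hb
      · rw [hmemnone huw] at hb
        rw [hmemnone hvw] at hb'
        exact (hadj u ⟨hu, huw⟩ v ⟨hv, hvw⟩ huv).1 (hcl ⟨hb, hu⟩ ⟨hb', hv⟩ huv)
      · exact ⟨b, (hmem huw b).1 hb, (hmem hvw b).1 hb'⟩
  · intro u hu
    by_cases huw : u = w
    · subst huw
      refine ⟨none, by simp [hf₂w], fun v _ hv => by simp [hf₂ hv]⟩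
    · obtain ⟨p, hp, hp'⟩ := hpriv u ⟨hu, huw⟩
      refine ⟨some (some p), (hmem huw p).2 hp, fun v hv hvu => ?_⟩
      by_cases hvw : v = w
      · subst hvw
        simp [hf₂w]
      · rw [hmem hvw]
        exact hp' v ⟨hv, hvw⟩ hvu
  · intro K hK hKcl
    by_cases hwK : w ∈ K
    · refine ⟨some none, fun u hu => ?_⟩
      by_cases huw : u = w
      · simp [huw, hf₂w]
      · exact (hmemnone huw).2 (hKcl hwK hu (Ne.symm huw))
    · have hne {u : V} (hu : u ∈ K) : u ≠ w := fun h => hwK (h ▸ hu)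
      obtain ⟨y, hy⟩ := hclq K (fun u hu => ⟨hK hu, hne hu⟩) hKcl
      exact ⟨some (some y), fun u hu => (hmem (hne hu) y).2 (hy u hu)⟩

/-- Every finite chordal graph has a proper subtree representation. -/
lemma IsChordal.exists_isProperSubtreeRep {V : Type*} [Finite V] {G : SimpleGraph V}
    (hG : IsChordal G) : ∃ (m : ℕ) (T : SimpleGraph (Fin m)) (f : V → Set (Fin m)),
      T.IsTree ∧ IsProperSubtreeRep G T f := by
  obtain ⟨β, _, T, f, hT, hsub, hadj, hpriv, -⟩ := hG.exists_rep Set.univ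
  obtain ⟨m, ⟨e⟩⟩ := Finite.exists_equiv_fin β
  refine ⟨m, T.map e.toEmbedding, fun v => e '' f v, (Iso.map e T).isTree_iff.1 hT,
    ⟨fun v => (hsub v trivial).image (Iso.map e T).toHom, fun u v huv => ?_⟩, fun u v huv h => ?_⟩
  · rw [hadj u trivial v trivial huv, ← Set.image_inter e.injective, Set.image_nonempty]
  · obtain ⟨p, hp, hp'⟩ := hpriv u trivial
    exact hp' v trivial huv.symm ((Set.image_subset_image_iff e.injective).1 h.subset hp)

lemma IsProperSubtreeRep.induce {α β : Type*} {G : SimpleGraph α} {T : SimpleGraph β}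
    {f : α → Set β} (hf : IsProperSubtreeRep G T f) (W : Set α) :
    IsProperSubtreeRep (G.induce W) T (fun a : W => f a) :=
  ⟨⟨fun a => hf.1.1 a, fun u v huv => hf.1.2 u v fun h => huv (Subtype.ext h)⟩,
    fun u v huv => hf.2 u v fun h => huv (Subtype.ext h)⟩

/-- The host tree of a representation of a graph that is not complete is nontrivial. -/
lemma IsSubtreeRep.nontrivial {α β : Type*} {G : SimpleGraph α} {T : SimpleGraph β}
    {f : α → Set β} (hf : IsSubtreeRep G T f) (hG : G ≠ ⊤) : Nontrivial β := by
  obtain ⟨u, v, huv, hnadj⟩ := ne_top_iff_exists_not_adj.1 hG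
  obtain ⟨⟨x, hx⟩⟩ := (hf.1 u).nonempty
  obtain ⟨⟨y, hy⟩⟩ := (hf.1 v).nonempty
  refine ⟨x, y, ?_⟩
  rintro rfl
  exact hnadj ((hf.2 u v huv).2 ⟨x, hx, hy⟩)

end Leafage

theorem stmt17 {V : Type*} [Fintype V] (G : SimpleGraph V) (hG : IsChordal G)
    (hc : G.Connected) (hnc : G ≠ ⊤) (W : Set V)
    (hWconn : (G.induce W).Connected) (hred : IsReduced (G.induce W)) :
    {a : W | IsMEP (G.induce W) a}.ncard ≤ properLeafage G := by
  obtain ⟨m, T, f, hT, hf⟩ := hG.exists_isProperSubtreeRep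
  refine le_csInf ⟨_, m, T, f, hT, hf, rfl⟩ ?_
  rintro L ⟨m, T, f, hT, hf, rfl⟩
  have := hf.1.nontrivial hnc
  exact ncard_isMEP_le_numLeaves hWconn hred hT (hf.induce W)
end
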